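/- Fix a constant γ > 0 and a function d : ℕ → ℕ with d(n) ≥ 2 for all n and d(n)/√n → 0 as n → ∞. Then there exist a constant C > 0 and n0 such that for all n ≥ n0 with d(n)·n even, writing d = d(n), M2 = nd(d−1) and i1 = ⌊(1+γ)(d−1)²/4⌋: for every i with 0 ≤ i ≤ i1 − 1 such that S_i is nonempty, if P is chosen uniformly at random from S_i, then E[ b_A(P) ] ≤ ( M2² − M2(d−1)(16i + 3d² + d + 6) ) + C·( d⁶ + M2·d² ). -/

import Mathlib

/-!
Formalization of the pairing model of random `d`-regular (multi)graphs and of the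
switchings used in the uniform sampler *REG* of Gao and Wormald,
"Uniform generation of random regular graphs".

Bins are elements of `Fin n`; each bin contains `d` points, so points are
elements of `Fin n × Fin d`.  A pairing is a perfect matching of the points,
modelled as a fixed-point-free involution on the points: the pairs of the
pairing are the orbits `{x, P.f x}`.
-/

namespace Reg

abbrev Point (n d : ℕ) := Fin n × Fin d

/-- A pairing: a perfect matching of the `d * n` points, encoded as a
fixed-point-free involution.  The pairs are the 2-element sets `{x, f x}`. -/
structure Pairing (n d : ℕ) where
  f : Point n d → Point n d
  invol : ∀ x, f (f x) = x
  nofix : ∀ x, f x ≠ x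

instance {n d : ℕ} : Finite (Pairing n d) :=
  Finite.of_injective (fun P => P.f) fun P Q h => by
    cases P; cases Q; congr

variable {n d : ℕ}

/-- The number of pairs of `P` with one point in bin `u` and one point in bin `v`
(for distinct bins `u ≠ v` this is the multiplicity of the edge `uv`). -/
def mult (P : Pairing n d) (u v : Fin n) : ℕ :=
  (Finset.univ.filter fun a : Point n d => a.1 = u ∧ (P.f a).1 = v).card

/-- Two bins are adjacent if some pair of the pairing joins them. -/
def Adj (P : Pairing n d) (u v : Fin n) : Prop := u ≠ v ∧ 1 ≤ mult P u v

/-- The number of loops of `P` (pairs whose two points lie in the same bin). -/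
def numLoops (P : Pairing n d) : ℕ :=
  (Finset.univ.filter fun a : Point n d => (P.f a).1 = a.1).card / 2

/-- The number of loops of `P` lying in bin `u`. -/
def loopsAt (P : Pairing n d) (u : Fin n) : ℕ :=
  (Finset.univ.filter fun a : Point n d => a.1 = u ∧ (P.f a).1 = u).card / 2

/-- The number of (unordered) pairs of distinct bins joined by exactly `k` pairs of `P`,
i.e. the number of edges of multiplicity exactly `k`. -/
def edgesWithMult (P : Pairing n d) (k : ℕ) : ℕ :=
  (Finset.univ.filter fun q : Fin n × Fin n => q.1 < q.2 ∧ mult P q.1 q.2 = k).card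

/-- `M1 = dn` as a real number. -/
noncomputable def M1R (n d : ℕ) : ℝ := (d : ℝ) * n

/-- `M2 = n d (d-1)` as a real number. -/
noncomputable def M2R (n d : ℕ) : ℝ := (n : ℝ) * d * ((d : ℝ) - 1)

/-- `M3 = n d (d-1) (d-2)` as a real number. -/
noncomputable def M3R (n d : ℕ) : ℝ := (n : ℝ) * d * ((d : ℝ) - 1) * ((d : ℝ) - 2)

/-- `i1 = ⌊(1+γ)(d-1)²/4⌋`. -/
noncomputable def i1Nat (d : ℕ) (γ : ℝ) : ℕ := (⌊(1 + γ) * ((d : ℝ) - 1) ^ 2 / 4⌋).toNat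

/-- The stratum `S_i` of the double-edge reduction phase: pairings with no loops,
every edge of multiplicity at most 2, and exactly `i` double edges. -/
def SD (n d i : ℕ) : Set (Pairing n d) :=
  {P | numLoops P = 0 ∧ (∀ u v : Fin n, u ≠ v → mult P u v ≤ 2) ∧ edgesWithMult P 2 = i}

/-- `Φ1 = ⋃_{0 ≤ i ≤ m} S_i`. -/
def Phi1 (n d m : ℕ) : Set (Pairing n d) := {P | ∃ i ≤ m, P ∈ SD n d i}

/-- The labelled data (points 1–8) of a d-switching. -/
structure DSwitch (n d : ℕ) where
  p1 : Point n d
  p2 : Point n d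
  p3 : Point n d
  p4 : Point n d
  p5 : Point n d
  p6 : Point n d
  p7 : Point n d
  p8 : Point n d

/-- The four target bin-pairs `u1u2, u1u3, v1v2, v1v3` of a d-switching. -/
def targets (s : DSwitch n d) : List (Fin n × Fin n) :=
  [(s.p1.1, s.p5.1), (s.p1.1, s.p7.1), (s.p2.1, s.p6.1), (s.p2.1, s.p8.1)]

/-- `s` is a valid d-switching on `P`. -/
def IsDSwitch (P : Pairing n d) (s : DSwitch n d) : Prop :=
  P.f s.p1 = s.p2 ∧ P.f s.p3 = s.p4 ∧ P.f s.p5 = s.p6 ∧ P.f s.p7 = s.p8 ∧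
  s.p1.1 = s.p3.1 ∧ s.p2.1 = s.p4.1 ∧ s.p1 ≠ s.p3 ∧
  mult P s.p1.1 s.p2.1 = 2 ∧ mult P s.p5.1 s.p6.1 = 1 ∧ mult P s.p7.1 s.p8.1 = 1 ∧
  [s.p1.1, s.p2.1, s.p5.1, s.p6.1, s.p7.1, s.p8.1].Pairwise (· ≠ ·)

/-- The number of target bin-pairs of `s` joined by at least one pair of `P`. -/
def joinedCount (P : Pairing n d) (s : DSwitch n d) : ℕ :=
  (targets s).countP fun t => decide (1 ≤ mult P t.1 t.2)

/-- A type I switching: a d-switching creating at most one new double edge. -/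
def IsTypeI (P : Pairing n d) (s : DSwitch n d) : Prop :=
  IsDSwitch P s ∧ (∀ t ∈ targets s, mult P t.1 t.2 ≤ 1) ∧ joinedCount P s ≤ 1

/-- A type I switching of class A: it creates no new double edge. -/
def IsTypeIA (P : Pairing n d) (s : DSwitch n d) : Prop := IsTypeI P s ∧ joinedCount P s = 0

/-- A type I switching of class B: it creates exactly one new double edge. -/
def IsTypeIB (P : Pairing n d) (s : DSwitch n d) : Prop := IsTypeI P s ∧ joinedCount P s = 1

/-- The labelled data (points 1–12) of a type II switching. -/
structure DSwitch2 (n d : ℕ) extends DSwitch n d where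
  p9 : Point n d
  p10 : Point n d
  p11 : Point n d
  p12 : Point n d

/-- A type II switching: a d-switching creating exactly two new double edges, both
incident with `u1` or both incident with `v1`, together with the labelling
`{9,10}, {11,12}` (with 9 and 12 in `u1`, resp. `v1`) of the two existing pairs
joining the two joined target bin-pairs. -/
def IsTypeII (P : Pairing n d) (s : DSwitch2 n d) : Prop :=
  IsDSwitch P s.toDSwitch ∧ (∀ t ∈ targets s.toDSwitch, mult P t.1 t.2 ≤ 1) ∧
  P.f s.p9 = s.p10 ∧ P.f s.p11 = s.p12 ∧
  ((s.p9.1 = s.p1.1 ∧ s.p12.1 = s.p1.1 ∧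
      ((s.p10.1 = s.p5.1 ∧ s.p11.1 = s.p7.1) ∨ (s.p10.1 = s.p7.1 ∧ s.p11.1 = s.p5.1)) ∧
      mult P s.p1.1 s.p5.1 = 1 ∧ mult P s.p1.1 s.p7.1 = 1 ∧
      mult P s.p2.1 s.p6.1 = 0 ∧ mult P s.p2.1 s.p8.1 = 0) ∨
    (s.p9.1 = s.p2.1 ∧ s.p12.1 = s.p2.1 ∧
      ((s.p10.1 = s.p6.1 ∧ s.p11.1 = s.p8.1) ∨ (s.p10.1 = s.p8.1 ∧ s.p11.1 = s.p6.1)) ∧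
      mult P s.p2.1 s.p6.1 = 1 ∧ mult P s.p2.1 s.p8.1 = 1 ∧
      mult P s.p1.1 s.p5.1 = 0 ∧ mult P s.p1.1 s.p7.1 = 0))

/-- Conjugating a pairing by a permutation of the points: the pairs of
`conj P τ` are the images under `τ` of the pairs of `P`. -/
def conj (P : Pairing n d) (τ : Equiv.Perm (Point n d)) : Pairing n d where
  f := fun x => τ (P.f (τ.symm x))
  invol := by intro x; simp [P.invol]
  nofix := by
    intro x h
    refine P.nofix (τ.symm x) ?_
    have h3 := congrArg τ.symm h
    simpa using h3

/-- The permutation performing a d-switching: it replaces the pairs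
`{1,2},{3,4},{5,6},{7,8}` by `{1,5},{3,7},{2,6},{4,8}`. -/
def dtau (s : DSwitch n d) : Equiv.Perm (Point n d) :=
  (Equiv.swap s.p4 s.p7).trans (Equiv.swap s.p2 s.p5)

/-- The pairing resulting from performing a d-switching. -/
def dResult (P : Pairing n d) (s : DSwitch n d) : Pairing n d := conj P (dtau s)

/-- `f_I(P)`: the number of type I switchings on `P`. -/
noncomputable def fI (P : Pairing n d) : ℕ := Nat.card {s : DSwitch n d // IsTypeI P s}

/-- `f_II(P)`: the number of type II switchings on `P`. -/
noncomputable def fII (P : Pairing n d) : ℕ := Nat.card {s : DSwitch2 n d // IsTypeII P s}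

/-- `b_A(P)`: the number of class A switchings from pairings in `Φ1` producing `P`. -/
noncomputable def bA (m : ℕ) (P : Pairing n d) : ℕ :=
  Nat.card {q : Pairing n d × DSwitch n d //
    q.1 ∈ Phi1 n d m ∧ IsTypeIA q.1 q.2 ∧ dResult q.1 q.2 = P}

/-- `b_B(P)`: the number of class B switchings (of type I or type II) from
pairings in `Φ1` producing `P`. -/
noncomputable def bB (m : ℕ) (P : Pairing n d) : ℕ :=
  Nat.card {q : Pairing n d × DSwitch n d //
    q.1 ∈ Phi1 n d m ∧ IsTypeIB q.1 q.2 ∧ dResult q.1 q.2 = P} +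
  Nat.card {q : Pairing n d × DSwitch2 n d //
    q.1 ∈ Phi1 n d m ∧ IsTypeII q.1 q.2 ∧ dResult q.1 q.2.toDSwitch = P}

/-- `B_D = ⌊(1+γ)(d-1)²/4⌋`. -/
noncomputable def BD (d : ℕ) (γ : ℝ) : ℕ := i1Nat d γ

/-- `B_L = max(⌈log dn⌉, 4d)`. -/
noncomputable def BL (n d : ℕ) : ℕ := max (⌈Real.log ((d : ℝ) * n)⌉.toNat) (4 * d)

/-- `B_T = max(⌈log dn⌉, ⌈d³/n⌉)`. -/
noncomputable def BT (n d : ℕ) : ℕ :=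
  max (⌈Real.log ((d : ℝ) * n)⌉.toNat) (⌈(d : ℝ) ^ 3 / (n : ℝ)⌉.toNat)

/-- The set `A` of pairings that are not initially rejected:
`D(P) ≤ B_D`, `L(P) ≤ B_L` and `T(P) ≤ B_T`. -/
def AccSet (n d : ℕ) (γ : ℝ) : Set (Pairing n d) :=
  {P | edgesWithMult P 2 ≤ BD d γ ∧ numLoops P ≤ BL n d ∧ edgesWithMult P 3 ≤ BT n d}

/-- The stratum `S^L_i` of the loop reduction phase. -/
def SL (n d : ℕ) (γ : ℝ) (i : ℕ) : Set (Pairing n d) :=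
  {P | numLoops P = i ∧ (∀ u : Fin n, loopsAt P u ≤ 1) ∧
    edgesWithMult P 2 ≤ BD d γ ∧ edgesWithMult P 3 ≤ BT n d ∧
    ∀ u v : Fin n, u ≠ v → mult P u v ≤ 3}

/-- The labelled data (points 1–6) of a type L switching. -/
structure LSwitch (n d : ℕ) where
  q1 : Point n d
  q2 : Point n d
  q3 : Point n d
  q4 : Point n d
  q5 : Point n d
  q6 : Point n d

/-- `s` is a valid type L switching on `P`. -/
def IsLSwitch (P : Pairing n d) (s : LSwitch n d) : Prop :=
  P.f s.q1 = s.q2 ∧ s.q1.1 = s.q2.1 ∧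
  P.f s.q3 = s.q4 ∧ P.f s.q5 = s.q6 ∧
  mult P s.q3.1 s.q4.1 = 1 ∧ mult P s.q5.1 s.q6.1 = 1 ∧
  [s.q1.1, s.q3.1, s.q4.1, s.q5.1, s.q6.1].Pairwise (· ≠ ·) ∧
  mult P s.q1.1 s.q3.1 = 0 ∧ mult P s.q1.1 s.q5.1 = 0 ∧ mult P s.q4.1 s.q6.1 = 0

/-- The permutation performing a type L switching: it replaces the pairs
`{1,2},{3,4},{5,6}` by `{1,3},{2,5},{4,6}`. -/
def ltau (s : LSwitch n d) : Equiv.Perm (Point n d) :=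
  (Equiv.swap s.q4 s.q5).trans (Equiv.swap s.q2 s.q3)

/-- The pairing resulting from performing a type L switching. -/
def lResult (P : Pairing n d) (s : LSwitch n d) : Pairing n d := conj P (ltau s)

/-- `f_L(P)`: the number of type L switchings on `P`. -/
noncomputable def fL (P : Pairing n d) : ℕ := Nat.card {s : LSwitch n d // IsLSwitch P s}

/-- `b_A^L(P)`: the number of type L switchings from pairings in
`⋃_{0 ≤ j ≤ B_L} S^L_j` producing `P`. -/
noncomputable def bAL (γ : ℝ) (P : Pairing n d) : ℕ :=
  Nat.card {q : Pairing n d × LSwitch n d //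
    (∃ j ≤ BL n d, q.1 ∈ SL n d γ j) ∧ IsLSwitch q.1 q.2 ∧ lResult q.1 q.2 = P}

/-- The stratum `S^T_i` of the triple-edge reduction phase. -/
def ST (n d : ℕ) (γ : ℝ) (i : ℕ) : Set (Pairing n d) :=
  {P | numLoops P = 0 ∧ edgesWithMult P 3 = i ∧ edgesWithMult P 2 ≤ BD d γ ∧
    ∀ u v : Fin n, u ≠ v → mult P u v ≤ 3}

/-- The labelled data (points 1–12) of a type T switching. -/
structure TSwitch (n d : ℕ) where
  r1 : Point n d
  r2 : Point n d
  r3 : Point n d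
  r4 : Point n d
  r5 : Point n d
  r6 : Point n d
  r7 : Point n d
  r8 : Point n d
  r9 : Point n d
  r10 : Point n d
  r11 : Point n d
  r12 : Point n d

/-- `s` is a valid type T switching on `P`. -/
def IsTSwitch (P : Pairing n d) (s : TSwitch n d) : Prop :=
  P.f s.r1 = s.r2 ∧ P.f s.r3 = s.r4 ∧ P.f s.r5 = s.r6 ∧
  P.f s.r7 = s.r8 ∧ P.f s.r9 = s.r10 ∧ P.f s.r11 = s.r12 ∧
  s.r1.1 = s.r3.1 ∧ s.r3.1 = s.r5.1 ∧ s.r2.1 = s.r4.1 ∧ s.r4.1 = s.r6.1 ∧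
  s.r1 ≠ s.r3 ∧ s.r3 ≠ s.r5 ∧ s.r1 ≠ s.r5 ∧
  mult P s.r1.1 s.r2.1 = 3 ∧
  mult P s.r7.1 s.r8.1 = 1 ∧ mult P s.r9.1 s.r10.1 = 1 ∧ mult P s.r11.1 s.r12.1 = 1 ∧
  [s.r1.1, s.r2.1, s.r7.1, s.r8.1, s.r9.1, s.r10.1, s.r11.1, s.r12.1].Pairwise (· ≠ ·) ∧
  mult P s.r1.1 s.r7.1 = 0 ∧ mult P s.r1.1 s.r9.1 = 0 ∧ mult P s.r1.1 s.r11.1 = 0 ∧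
  mult P s.r2.1 s.r8.1 = 0 ∧ mult P s.r2.1 s.r10.1 = 0 ∧ mult P s.r2.1 s.r12.1 = 0

/-- The permutation performing a type T switching: it replaces the pairs
`{1,2},{3,4},{5,6},{7,8},{9,10},{11,12}` by `{1,7},{2,8},{3,9},{4,10},{5,11},{6,12}`. -/
def ttau (s : TSwitch n d) : Equiv.Perm (Point n d) :=
  ((Equiv.swap s.r2 s.r7).trans (Equiv.swap s.r4 s.r9)).trans (Equiv.swap s.r6 s.r11)

/-- The pairing resulting from performing a type T switching. -/
def tResult (P : Pairing n d) (s : TSwitch n d) : Pairing n d := conj P (ttau s)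

/-- `f_T(P)`: the number of type T switchings on `P`. -/
noncomputable def fT (P : Pairing n d) : ℕ := Nat.card {s : TSwitch n d // IsTSwitch P s}

/-- `b_A^T(P)`: the number of type T switchings from pairings in
`⋃_{0 ≤ j ≤ B_T} S^T_j` producing `P`. -/
noncomputable def bAT (γ : ℝ) (P : Pairing n d) : ℕ :=
  Nat.card {q : Pairing n d × TSwitch n d //
    (∃ j ≤ BT n d, q.1 ∈ ST n d γ j) ∧ IsTSwitch q.1 q.2 ∧ tResult q.1 q.2 = P}

/-- The endpoints of the pair of `P` containing the point `a` lie in bins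
`w1, w2` such that `u, v, w1, w2` are four distinct bins, `w1` is adjacent to `u`
and `w2` is adjacent to `v`. -/
def GoodPair (u v : Fin n) (P : Pairing n d) (a : Point n d) : Prop :=
  ∃ w1 w2 : Fin n,
    ((w1 = a.1 ∧ w2 = (P.f a).1) ∨ (w1 = (P.f a).1 ∧ w2 = a.1)) ∧
    [u, v, w1, w2].Pairwise (· ≠ ·) ∧ Adj P w1 u ∧ Adj P w2 v

/-- Four times the number of unordered pairs `{e, e'}` of distinct pairs of `P`
joining the same two distinct bins: ordered pairs of points `(a, b)` lying in a
common bin whose mates also lie in a common (different) bin. -/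
def parallelOrdered (P : Pairing n d) : ℕ :=
  (Finset.univ.filter fun q : Point n d × Point n d =>
    q.1.1 = q.2.1 ∧ (P.f q.1).1 = (P.f q.2).1 ∧ q.1.1 ≠ (P.f q.1).1 ∧ q.1 ≠ q.2).card

/-- Twice the number of unordered pairs of two distinct double edges of `P`
sharing a common bin (double edges being recorded as ordered bin-pairs `(u,v)`
with `u < v`). -/
def doubleSharedOrdered (P : Pairing n d) : ℕ :=
  (Finset.univ.filter fun q : (Fin n × Fin n) × (Fin n × Fin n) =>
    q.1.1 < q.1.2 ∧ q.2.1 < q.2.2 ∧ mult P q.1.1 q.1.2 = 2 ∧ mult P q.2.1 q.2.2 = 2 ∧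
    q.1 ≠ q.2 ∧
    (q.1.1 = q.2.1 ∨ q.1.1 = q.2.2 ∨ q.1.2 = q.2.1 ∨ q.1.2 = q.2.2)).card

/-- `m̄_I(i) = 4 i (M1 - 4i)²`. -/
noncomputable def mbarIp (nR dR : ℝ) (i : ℕ) : ℝ := 4 * i * (dR * nR - 4 * i) ^ 2

/-- `m̄_II(i) = 16 i (d-1)² (d-2) (d-3)`. -/
noncomputable def mbarIIp (dR : ℝ) (i : ℕ) : ℝ :=
  16 * i * (dR - 1) ^ 2 * (dR - 2) * (dR - 3)

/-- `m̲_A(i) = M2² - M2 (d-1) (16 i + 3d² + d + 6)`. -/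
noncomputable def mAp (nR dR : ℝ) (i : ℕ) : ℝ :=
  (nR * dR * (dR - 1)) ^ 2 - nR * dR * (dR - 1) * (dR - 1) * (16 * i + 3 * dR ^ 2 + dR + 6)

/-- `m̲_B(i) = 16 i (d-2) M2 - 16 i d (8 i d + 9 d² + 3 d³)`. -/
noncomputable def mBp (nR dR : ℝ) (i : ℕ) : ℝ :=
  16 * i * (dR - 2) * (nR * dR * (dR - 1)) - 16 * i * dR * (8 * i * dR + 9 * dR ^ 2 + 3 * dR ^ 3)

/-- The system of equations (18)–(21) of the paper determining the type
probabilities `ρ_I, ρ_II` and the (scaled) expected numbers of visits `x_j`,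
together with the positivity requirement on the `x_j`. -/
def Sys (nR dR ε : ℝ) (m : ℕ) (x ρI ρII : ℕ → ℝ) : Prop :=
  (∀ j ≤ m, 0 < x j) ∧
  (∀ i : ℕ, 1 ≤ i → i ≤ m → ρI i = 1 - ε) ∧
  ρI 0 = 0 ∧ ρII 0 = 0 ∧ ρII m = 0 ∧
  (∀ j : ℕ, 1 ≤ j → j + 1 ≤ m →
    x j = 1 + x (j + 1) * ρI (j + 1) * mAp nR dR j / mbarIp nR dR (j + 1)
        + x j * ρI j * mBp nR dR j / mbarIp nR dR j) ∧
  (x m = 1 + x m * ρI m * mBp nR dR m / mbarIp nR dR m) ∧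
  (x 0 = 1 + x 1 * ρI 1 * mAp nR dR 0 / mbarIp nR dR 1) ∧
  (∀ j : ℕ, j + 1 ≤ m →
    ρII j = ρI (j + 1) * (x (j + 1) / x j) * (mbarIIp dR j / mbarIp nR dR (j + 1)))

/-- The explicit unique positive root `x(d)`. -/
noncomputable def xd (dR : ℝ) : ℝ :=
  (7 / 2) * dR - 7 / 2 + 5 / dR +
    (1 / (2 * dR)) * Real.sqrt (65 * dR ^ 4 - 210 * dR ^ 3 + 461 * dR ^ 2 - 412 * dR + 196)

section Helpers

open Classical

/-- Two points lie on parallel pairs, read from the same end. -/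
def Par (P : Pairing n d) (p q : Point n d) : Prop := p.1 = q.1 ∧ (P.f p).1 = (P.f q).1

/-- The point `p` lies on a multiple edge. -/
def Dbl (P : Pairing n d) (p : Point n d) : Prop := ∃ q, q ≠ p ∧ Par P p q

/-- No loops. -/
def NoLoop (P : Pairing n d) : Prop := ∀ p, (P.f p).1 ≠ p.1

/-- No three distinct points lie on mutually parallel pairs. -/
def MultTwo (P : Pairing n d) : Prop :=
  ∀ p q r, Par P p q → Par P p r → p = q ∨ p = r ∨ q = r

lemma numLoops_eq_zero_iff (P : Pairing n d) : numLoops P = 0 ↔ NoLoop P := by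
  unfold numLoops NoLoop
  constructor
  · intro h p hp
    have h2 : ({p, P.f p} : Finset (Point n d)).card = 2 :=
      Finset.card_pair (P.nofix p).symm
    have h3 : ({p, P.f p} : Finset (Point n d)) ⊆
        Finset.univ.filter fun a : Point n d => (P.f a).1 = a.1 := by
      intro a ha
      simp only [Finset.mem_insert, Finset.mem_singleton] at ha
      rcases ha with rfl | rfl <;> simp [P.invol, hp]
    have := Finset.card_le_card h3
    omega
  · intro h
    have : (Finset.univ.filter fun a : Point n d => (P.f a).1 = a.1) = ∅ := by
      ext a; simp [h a]
    rw [this]; simp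

lemma mult_comm (P : Pairing n d) (u v : Fin n) : mult P u v = mult P v u := by
  unfold mult
  refine Finset.card_bij' (fun a _ => P.f a) (fun a _ => P.f a) ?_ ?_ ?_ ?_ <;>
    simp +contextual [P.invol]

lemma mult_pos_iff (P : Pairing n d) (u v : Fin n) :
    1 ≤ mult P u v ↔ ∃ q : Point n d, q.1 = u ∧ (P.f q).1 = v := by
  unfold mult
  rw [Nat.one_le_iff_ne_zero, Finset.card_ne_zero]
  constructor
  · rintro ⟨q, hq⟩; exact ⟨q, by simpa using hq⟩
  · rintro ⟨q, hq⟩; exact ⟨q, by simpa using hq⟩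

lemma dbl_iff_mult (P : Pairing n d) (p : Point n d) :
    Dbl P p ↔ 2 ≤ mult P p.1 (P.f p).1 := by
  unfold mult
  change _ ↔ 1 < _
  rw [Finset.one_lt_card]
  constructor
  · rintro ⟨q, hq, h1, h2⟩
    exact ⟨p, by simp, q, by simp [h1, h2], hq.symm⟩
  · rintro ⟨a, ha, b, hb, hab⟩
    simp only [Finset.mem_filter, Finset.mem_univ, true_and] at ha hb
    by_cases h : a = p
    · exact ⟨b, by grind, hb.1.symm, hb.2.symm⟩
    · exact ⟨a, h, ha.1.symm, ha.2.symm⟩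

lemma mult_le_two_iff (P : Pairing n d) (h : NoLoop P) :
    (∀ u v : Fin n, u ≠ v → mult P u v ≤ 2) ↔ MultTwo P := by
  constructor
  · intro hm p q r hq hr
    have := hm p.1 (P.f p).1 (h p).symm
    by_contra! hne
    have h2 : 2 < mult P p.1 (P.f p).1 := by
      unfold mult
      rw [Finset.two_lt_card]
      exact ⟨p, by simp, q, by simp [hq.1, hq.2], r, by simp [hr.1, hr.2],
        hne.1, hne.2.1, hne.2.2⟩
    omega
  · intro hm u v _
    by_contra! h2
    unfold mult at h2
    rw [Finset.two_lt_card] at h2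
    obtain ⟨a, ha, b, hb, c, hc, h1, h2, h3⟩ := h2
    simp only [Finset.mem_filter, Finset.mem_univ, true_and] at ha hb hc
    have := hm a b c ⟨by grind, by grind⟩ ⟨by grind, by grind⟩
    tauto

lemma card_dbl (P : Pairing n d) (h : NoLoop P) (h2 : MultTwo P) :
    (Finset.univ.filter fun p : Point n d => Dbl P p).card = 4 * edgesWithMult P 2 := by
  have hm := (mult_le_two_iff P h).2 h2
  have hD : ∀ p, Dbl P p ↔ mult P p.1 (P.f p).1 = 2 := by
    intro p
    rw [dbl_iff_mult]
    have := hm p.1 (P.f p).1 (h p).symm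
    omega
  have key : ∀ s : Finset (Fin n × Fin n), (∀ q ∈ s, mult P q.1 q.2 = 2) →
      (Finset.univ.filter fun p : Point n d => (p.1, (P.f p).1) ∈ s).card = 2 * s.card := by
    intro s hs
    rw [Finset.card_eq_sum_card_fiberwise (t := s) (f := fun p : Point n d => (p.1, (P.f p).1))
      (by intro p hp; simpa using hp)]
    rw [Finset.sum_congr rfl (g := fun _ => 2)]
    · simp [mul_comm]
    · intro q hq
      rw [← hs q hq]
      unfold mult
      congr 1
      ext p
      simp only [Finset.mem_filter, Finset.mem_univ, true_and]
      constructor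
      · rintro ⟨_, h⟩; rw [← h]; simp
      · rintro ⟨h, h'⟩; rw [h, h']; simp [hq]
  set s1 := Finset.univ.filter fun q : Fin n × Fin n => q.1 < q.2 ∧ mult P q.1 q.2 = 2 with hs1
  set s2 := Finset.univ.filter fun q : Fin n × Fin n => q.2 < q.1 ∧ mult P q.1 q.2 = 2 with hs2
  have hcard : s2.card = s1.card := by
    refine Finset.card_bij' (fun q _ => (q.2, q.1)) (fun q _ => (q.2, q.1)) ?_ ?_ ?_ ?_
    all_goals simp +contextual [hs1, hs2, mult_comm]
  have hdisj : Disjoint s1 s2 := by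
    rw [Finset.disjoint_left]
    intro q h1 h2
    simp only [hs1, hs2, Finset.mem_filter] at h1 h2
    exact lt_asymm h1.2.1 h2.2.1
  have hk := key (s1 ∪ s2) (by
    intro q hq
    simp only [hs1, hs2, Finset.mem_union, Finset.mem_filter] at hq
    tauto)
  rw [Finset.card_union_of_disjoint hdisj, hcard] at hk
  have he : edgesWithMult P 2 = s1.card := rfl
  rw [he]
  have : (Finset.univ.filter fun p : Point n d => Dbl P p) =
      Finset.univ.filter fun p : Point n d => (p.1, (P.f p).1) ∈ s1 ∪ s2 := by
    ext p
    have := h p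
    simp only [hD, hs1, hs2, Finset.mem_filter, Finset.mem_univ, true_and, Finset.mem_union]
    have := lt_trichotomy p.1 (P.f p).1
    grind
  rw [this, hk]
  omega

lemma mem_SD_iff (P : Pairing n d) (i : ℕ) :
    P ∈ SD n d i ↔ NoLoop P ∧ MultTwo P ∧
      (Finset.univ.filter fun p : Point n d => Dbl P p).card = 4 * i := by
  unfold SD
  simp only [Set.mem_ofPred_eq, numLoops_eq_zero_iff]
  constructor
  · rintro ⟨h, h2, h3⟩
    have := (mult_le_two_iff P h).1 h2
    exact ⟨h, this, by rw [card_dbl P h this, h3]⟩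
  · rintro ⟨h, h2, h3⟩
    rw [card_dbl P h h2] at h3
    exact ⟨h, (mult_le_two_iff P h).2 h2, by omega⟩

lemma conj_mem_SD (P : Pairing n d) (τ : Equiv.Perm (Point n d)) (i : ℕ)
    (hl : ∀ p, (τ (P.f p)).1 = (τ p).1 → (P.f p).1 = p.1)
    (hp : ∀ p q, Par P p q ↔ Par (conj P τ) (τ p) (τ q)) (h : P ∈ SD n d i) :
    conj P τ ∈ SD n d i ∧ ∀ p, Dbl P p ↔ Dbl (conj P τ) (τ p) := by
  have hD : ∀ p, Dbl P p ↔ Dbl (conj P τ) (τ p) := by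
    intro p
    unfold Dbl
    constructor
    · rintro ⟨q, h1, h2⟩
      exact ⟨τ q, by simpa using h1, (hp p q).1 h2⟩
    · rintro ⟨q, h1, h2⟩
      refine ⟨τ.symm q, ?_, (hp _ _).2 (by simpa using h2)⟩
      rintro rfl; simp at h1
  refine ⟨?_, hD⟩
  rw [mem_SD_iff] at h ⊢
  obtain ⟨h1, h2, h3⟩ := h
  refine ⟨?_, ?_, ?_⟩
  · intro p hh
    refine h1 (τ.symm p) (hl _ ?_)
    simpa [conj] using hh
  · intro p q r hq hr
    have := h2 (τ.symm p) (τ.symm q) (τ.symm r) ((hp _ _).2 (by simpa using hq))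
      ((hp _ _).2 (by simpa using hr))
    simpa using this
  · rw [← h3]
    refine (Finset.card_bij (fun a _ => τ a) ?_ ?_ ?_).symm
    · intro a ha
      simpa [← hD] using ha
    · intro a _ b _ hab; simpa using hab
    · intro b hb
      refine ⟨τ.symm b, ?_, by simp⟩
      simpa [hD] using hb

lemma reroute_aux {α β : Type*} [DecidableEq α] (bin : α → β) (f : α → α) (i0 : ∀ z, f (f z) = z)
   (hl : ∀ p, bin (f p) ≠ bin p) (q b x y : α) (hqb : f q = b) (hxy : f x = y)
   (hq : ∀ z, z ≠ q → bin q = bin z → bin b ≠ bin (f z))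
   (hx : ∀ z, z ≠ x → bin x = bin z → bin y ≠ bin (f z))
   (hb : ∀ z, z ≠ b → bin b = bin z → bin q ≠ bin (f z))
   (hy : ∀ z, z ≠ y → bin y = bin z → bin x ≠ bin (f z))
   (h1 : bin x ≠ bin q) (h2 : bin y ≠ bin b)
   (h3 : ∀ z, bin z = bin q → bin (f z) ≠ bin x)
   (h4 : ∀ z, bin z = bin b → bin (f z) ≠ bin y)
   (p r : α) : (bin p = bin r ∧ bin (f p) = bin (f r)) ↔ (bin (Equiv.swap b x p) = bin (Equiv.swap b x r) ∧
     bin (Equiv.swap b x (f p)) = bin (Equiv.swap b x (f r))) := by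
  have e1 : f b = q := by rw [← hqb, i0]
  have e2 : f y = x := by rw [← hxy, i0]
  have hcl : ∀ z, z = b ∨ z = x ∨ z = q ∨ z = y ∨
      (Equiv.swap b x z = z ∧ Equiv.swap b x (f z) = f z ∧ z ≠ b ∧ z ≠ x ∧ z ≠ q ∧ z ≠ y) := by
    intro z
    simp only [Equiv.swap_apply_def]
    grind
  have s1 : Equiv.swap b x b = x := by simp
  have s2 : Equiv.swap b x x = b := by simp
  have hqx : bin q ≠ bin b := by have := hl q; grind
  have hyx : bin y ≠ bin x := by have := hl x; grind
  have n1 : bin b ≠ bin x := by have := h3 q rfl; grind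
  have n2 : bin q ≠ bin y := by have := h4 b rfl; grind
  have s3 : Equiv.swap b x q = q := by rw [Equiv.swap_apply_of_ne_of_ne] <;> grind
  have s4 : Equiv.swap b x y = y := by rw [Equiv.swap_apply_of_ne_of_ne] <;> grind
  have a1 := hq p
  have a2 := hq r
  have a3 := hx p
  have a4 := hx r
  have a5 := hb p
  have a6 := hb r
  have a7 := hy p
  have a8 := hy r
  have a9 := h3 p
  have b1 := h3 r
  have b2 := h4 p
  have b3 := h4 r
  have b4 := h3 (f p)
  have b5 := h3 (f r)
  have b6 := h4 (f p)
  have b7 := h4 (f r)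
  rw [i0] at b4 b5 b6 b7
  have c1 := hcl p
  have c2 := hcl r
  clear hq hx hb hy h3 h4 hl i0 hcl
  rcases c1 with h | h | h | h | h <;> rcases c2 with h' | h' | h' | h' | h' <;> grind

lemma relocate_aux {α β : Type*} (bin : α → β) (f : α → α) (i0 : ∀ z, f (f z) = z)
   (hl : ∀ p, bin (f p) ≠ bin p) (p a b c x y X Y : α)
   (hpb : f p = b) (hac : f a = c) (hxX : f x = X) (hyY : f y = Y)
   (τ : α → α) (t1 : τ p = x) (t2 : τ x = p) (t3 : τ a = y) (t4 : τ y = a)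
   (t5 : ∀ z, z ≠ p → z ≠ a → z ≠ x → z ≠ y → τ z = z)
   (hpa : bin p = bin a) (hbc : bin b = bin c) (hxy : bin x = bin y)
   (hp : ∀ z, bin p = bin z → bin b = bin (f z) → z = p ∨ z = a)
   (hx : ∀ z, z ≠ x → bin x = bin z → bin X ≠ bin (f z))
   (hy : ∀ z, z ≠ y → bin y = bin z → bin Y ≠ bin (f z))
   (hxy' : x ≠ y)
   (h1 : bin x ≠ bin p) (h2 : bin x ≠ bin b) (h3 : bin X ≠ bin p) (h4 : bin Y ≠ bin p)
   (g1 : ∀ z, bin z = bin b → bin (f z) ≠ bin x)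
   (g2 : ∀ z, bin z = bin p → bin (f z) ≠ bin X)
   (g3 : ∀ z, bin z = bin p → bin (f z) ≠ bin Y) :
   (∀ r, bin (τ (f r)) = bin (τ r) → bin (f r) = bin r) ∧
   ∀ r s, (bin r = bin s ∧ bin (f r) = bin (f s)) ↔ (bin (τ r) = bin (τ s) ∧
     bin (τ (f r)) = bin (τ (f s))) := by
  have e1 : f b = p := by rw [← hpb, i0]
  have e2 : f c = a := by rw [← hac, i0]
  have e3 : f X = x := by rw [← hxX, i0]
  have e4 : f Y = y := by rw [← hyY, i0]
  have l1 := hl p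
  have l2 := hl a
  have l3 := hl x
  have l4 := hl y
  have k1 := g1 b rfl
  have k2 := g1 c hbc.symm
  have k3 := g2 p rfl
  have k4 := g3 p rfl
  have k5 : bin X ≠ bin Y := by have := hx y hxy'.symm hxy; grind
  have k6 : bin X ≠ bin b := by have := g1 X; grind
  have k7 : bin Y ≠ bin b := by have := g1 Y; grind
  rw [hpb] at l1 k3 k4
  rw [hac] at l2
  rw [hxX] at l3
  rw [hyY] at l4
  rw [e1] at k1
  rw [e2] at k2
  have u1 : τ b = b := by apply t5 <;> grind
  have u2 : τ c = c := by apply t5 <;> grind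
  have u3 : τ X = X := by apply t5 <;> grind
  have u4 : τ Y = Y := by apply t5 <;> grind
  have hcl : ∀ z, z = p ∨ z = a ∨ z = x ∨ z = y ∨ z = b ∨ z = c ∨ z = X ∨ z = Y ∨
      (τ z = z ∧ τ (f z) = f z ∧ z ≠ p ∧ z ≠ a ∧ z ≠ x ∧ z ≠ y ∧ z ≠ b ∧ z ≠ c ∧ z ≠ X ∧ z ≠ Y) := by
    intro z
    by_cases hz : z = p ∨ z = a ∨ z = x ∨ z = y ∨ z = b ∨ z = c ∨ z = X ∨ z = Y
    · tauto
    · push Not at hz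
      have := i0 z
      have v1 : τ z = z := by apply t5 <;> grind
      have v2 : τ (f z) = f z := by apply t5 <;> grind
      tauto
  constructor
  · intro r
    have c1 := hcl r
    clear hp hx hy g1 g2 g3 hcl t5
    rcases c1 with h | h | h | h | h | h | h | h | h <;> grind
  intro r s
  have a1 := hp r
  have a2 := hp s
  have a3 := hx r
  have a4 := hx s
  have a5 := hy r
  have a6 := hy s
  have a11 := hp (f r)
  have a21 := hp (f s)
  have a31 := hx (f r)
  have a41 := hx (f s)
  have a51 := hy (f r)
  have a61 := hy (f s)
  have b1 := g1 r
  have b2 := g1 s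
  have b3 := g1 (f r)
  have b4 := g1 (f s)
  have b5 := g2 r
  have b6 := g2 s
  have b7 := g2 (f r)
  have b8 := g2 (f s)
  have d5 := g3 r
  have d6 := g3 s
  have d7 := g3 (f r)
  have d8 := g3 (f s)
  rw [i0] at a11 a21 a31 a41 a51 a61 b3 b4 b7 b8 d7 d8
  have c1 := hcl r
  have c2 := hcl s
  clear hp hx hy g1 g2 g3 hl i0 hcl t5
  rcases c1 with h | h | h | h | h | h | h | h | h <;>
    rcases c2 with h' | h' | h' | h' | h' | h' | h' | h' | h' <;> grind

lemma conj_f (P : Pairing n d) (τ : Equiv.Perm (Point n d)) (p : Point n d) :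
    (conj P τ).f p = τ (P.f (τ.symm p)) := rfl

lemma Pairing.ext_f {P Q : Pairing n d} (h : ∀ p, P.f p = Q.f p) : P = Q := by
  cases P; cases Q
  congr
  exact funext h

lemma conj_symm_conj (P : Pairing n d) (τ : Equiv.Perm (Point n d)) :
    conj (conj P τ) τ.symm = P := by
  apply Pairing.ext_f
  intro p
  simp [conj_f]

lemma par_conj_iff (P : Pairing n d) (τ : Equiv.Perm (Point n d)) (p q : Point n d) :
    Par (conj P τ) (τ p) (τ q) ↔
      (τ p).1 = (τ q).1 ∧ (τ (P.f p)).1 = (τ (P.f q)).1 := by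
  simp [Par, conj_f]

lemma par_symm {P : Pairing n d} {p q : Point n d} (h : Par P p q) : Par P q p :=
  ⟨h.1.symm, h.2.symm⟩

lemma par_f {P : Pairing n d} {p q : Point n d} (h : Par P p q) : Par P (P.f p) (P.f q) :=
  ⟨h.2, by simpa [P.invol] using h.1⟩

lemma not_dbl_f {P : Pairing n d} {p : Point n d} (h : ¬ Dbl P p) : ¬ Dbl P (P.f p) := by
  rintro ⟨r, h1, h2⟩
  refine h ⟨P.f r, ?_, ?_⟩
  · rintro rfl; exact h1 (by rw [P.invol])
  · have := par_f h2
    rwa [P.invol] at this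

/-- `x` may be used to reroute the single pair at `q`. -/
def Reroute (P : Pairing n d) (q x : Point n d) : Prop :=
  ¬ Dbl P x ∧ x.1 ≠ q.1 ∧ (P.f x).1 ≠ (P.f q).1 ∧
    (∀ z : Point n d, z.1 = q.1 → (P.f z).1 ≠ x.1) ∧
    (∀ z : Point n d, z.1 = (P.f q).1 → (P.f z).1 ≠ (P.f x).1)

lemma reroute_mem (P : Pairing n d) (i : ℕ) (hP : P ∈ SD n d i) (q x : Point n d)
    (hq : ¬ Dbl P q) (hx : Reroute P q x) :
    conj P (Equiv.swap (P.f q) x) ∈ SD n d i := by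
  obtain ⟨hl, -, -⟩ := (mem_SD_iff P i).1 hP
  obtain ⟨hxd, h1, h2, h3, h4⟩ := hx
  have hb := not_dbl_f hq
  have hy := not_dbl_f hxd
  have i0 := P.invol
  unfold Dbl Par at hq hxd hb hy
  push Not at hq hxd hb hy
  rw [i0] at hb hy
  refine (conj_mem_SD P _ i ?_ ?_ hP).1
  · intro p
    simp only [Equiv.swap_apply_def]
    have hl1 := hl p
    have hl2 := hl q
    have := i0 p
    have := h3 p
    have := h3 q
    have := h3 (P.f p)
    grind
  · intro p r
    rw [par_conj_iff]
    exact reroute_aux Prod.fst P.f i0 hl q _ x _ rfl rfl hq hxd hb hy h1 h2 h3 h4 p r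

/-- The wedge `w` may receive the double edge at `p`. -/
def Relocate (P : Pairing n d) (p : Point n d) (w : Point n d × Point n d) : Prop :=
  ¬ Dbl P w.1 ∧ ¬ Dbl P w.2 ∧ w.1.1 ≠ p.1 ∧ w.1.1 ≠ (P.f p).1 ∧
  (P.f w.1).1 ≠ p.1 ∧ (P.f w.2).1 ≠ p.1 ∧
  (∀ z : Point n d, z.1 = (P.f p).1 → (P.f z).1 ≠ w.1.1) ∧
  (∀ z : Point n d, z.1 = p.1 → (P.f z).1 ≠ (P.f w.1).1) ∧
  (∀ z : Point n d, z.1 = p.1 → (P.f z).1 ≠ (P.f w.2).1)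

lemma relocate_mem_aux (P : Pairing n d) (i : ℕ) (hP : P ∈ SD n d i) (p a x y : Point n d)
    (hpa : Par P p a) (hxy : x.1 = y.1) (hxy' : x ≠ y)
    (hw : Relocate P p (x, y)) (τ : Equiv.Perm (Point n d))
    (t1 : τ p = x) (t2 : τ x = p) (t3 : τ a = y) (t4 : τ y = a)
    (t5 : ∀ z, z ≠ p → z ≠ a → z ≠ x → z ≠ y → τ z = z) :
    conj P τ ∈ SD n d i ∧ (∀ r, Dbl P r → r ≠ p → r ≠ a → Dbl (conj P τ) r) ∧
      Par (conj P τ) x y := by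
  obtain ⟨hl, hm, -⟩ := (mem_SD_iff P i).1 hP
  obtain ⟨hxd, hyd, h1, h2, h3, h4, g1, g2, g3⟩ := hw
  have hxd' := hxd
  have hyd' := hyd
  unfold Dbl Par at hxd hyd
  push Not at hxd hyd
  have key := relocate_aux Prod.fst P.f P.invol hl p a _ _ x y _ _ rfl rfl rfl rfl τ t1 t2 t3 t4
    t5 hpa.1 hpa.2 hxy (by
      intro z z1 z2
      have := hm p a z hpa ⟨z1, z2⟩
      grind) hxd hyd hxy' h1 h2 h3 h4 g1 g2 g3
  have hpar : ∀ r s, Par P r s ↔ Par (conj P τ) (τ r) (τ s) := by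
    intro r s
    rw [par_conj_iff]
    exact key.2 r s
  have hc := conj_mem_SD P τ i key.1 hpar hP
  refine ⟨hc.1, ?_, ?_⟩
  · intro r hr r1 r2
    have := (hc.2 r).1 hr
    rwa [t5 r r1 r2 (by rintro rfl; exact hxd' hr) (by rintro rfl; exact hyd' hr)] at this
  · have := (hpar p a).1 hpa
    rwa [t1, t3] at this

lemma relocate_mem (P : Pairing n d) (i : ℕ) (hP : P ∈ SD n d i) (p a x y : Point n d)
    (hpa : Par P p a) (hne : p ≠ a) (hxy : x.1 = y.1) (hxy' : x ≠ y)
    (hw : Relocate P p (x, y)) :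
    conj P ((Equiv.swap p x).trans (Equiv.swap a y)) ∈ SD n d i ∧
      (∀ r, Dbl P r → r ≠ p → r ≠ a →
        Dbl (conj P ((Equiv.swap p x).trans (Equiv.swap a y))) r) ∧
      Par (conj P ((Equiv.swap p x).trans (Equiv.swap a y))) x y := by
  have h1 := hw.2.2.1
  simp only at h1
  have hpa1 := hpa.1
  have npx : p ≠ x := by rintro rfl; exact h1 rfl
  have npy : p ≠ y := by rintro rfl; exact h1 hxy
  have nax : a ≠ x := by rintro rfl; exact h1 hpa1.symm
  have nay : a ≠ y := by rintro rfl; exact h1 (hxy.trans hpa1.symm)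
  refine relocate_mem_aux P i hP p a x y hpa hxy hxy' hw _ ?_ ?_ ?_ ?_ ?_
  · rw [Equiv.trans_apply, Equiv.swap_apply_left, Equiv.swap_apply_of_ne_of_ne nax.symm hxy']
  · rw [Equiv.trans_apply, Equiv.swap_apply_right, Equiv.swap_apply_of_ne_of_ne hne npy]
  · rw [Equiv.trans_apply, Equiv.swap_apply_of_ne_of_ne hne.symm nax, Equiv.swap_apply_left]
  · rw [Equiv.trans_apply, Equiv.swap_apply_of_ne_of_ne npy.symm hxy'.symm,
      Equiv.swap_apply_right]
  · intro z z1 z2 z3 z4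
    rw [Equiv.trans_apply, Equiv.swap_apply_of_ne_of_ne z1 z3,
      Equiv.swap_apply_of_ne_of_ne z2 z4]

lemma card_bin (u : Fin n) :
    (Finset.univ.filter fun p : Point n d => p.1 = u).card = d := by
  have : (Finset.univ.filter fun p : Point n d => p.1 = u) =
      ({u} : Finset (Fin n)) ×ˢ (Finset.univ : Finset (Fin d)) := by
    ext ⟨a, b⟩; simp [eq_comm]
  rw [this, Finset.card_product]; simp

lemma card_f_bin (P : Pairing n d) (u : Fin n) :
    (Finset.univ.filter fun p : Point n d => (P.f p).1 = u).card = d := by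
  refine Eq.trans ?_ (card_bin (d := d) u)
  refine Finset.card_bij' (fun a _ => P.f a) (fun a _ => P.f a) ?_ ?_ ?_ ?_ <;>
    simp +contextual [P.invol]

/-- Ordered pairs of distinct points in a common bin. -/
def wed (n d : ℕ) : Finset (Point n d × Point n d) :=
  Finset.univ.filter fun w => w.1.1 = w.2.1 ∧ w.1 ≠ w.2

lemma mem_wed (w : Point n d × Point n d) : w ∈ wed n d ↔ w.1.1 = w.2.1 ∧ w.1 ≠ w.2 := by
  simp [wed]

lemma card_wed_fst (s : Finset (Point n d)) :
    ((wed n d).filter fun w => w.1 ∈ s).card = s.card * (d - 1) := by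
  rw [Finset.card_eq_sum_card_fiberwise (t := s) (f := fun w => w.1)
    (by intro w hw; simp at hw; exact hw.2)]
  rw [Finset.sum_congr rfl (g := fun _ => d - 1)]
  · simp
  · intro p hp
    have : (((wed n d).filter fun w => w.1 ∈ s).filter fun w => w.1 = p).card =
        ((Finset.univ.filter fun q : Point n d => q.1 = p.1).erase p).card := by
      refine Finset.card_bij' (fun w _ => w.2) (fun q _ => (p, q)) ?_ ?_ ?_ ?_
      · intro w hw
        simp only [Finset.mem_filter, mem_wed] at hw
        simp only [Finset.mem_erase, Finset.mem_filter, Finset.mem_univ, true_and]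
        obtain ⟨⟨⟨h1, h2⟩, h3⟩, h4⟩ := hw
        exact ⟨by rw [← h4]; exact h2.symm, by rw [← h4]; exact h1.symm⟩
      · intro q hq
        simp only [Finset.mem_erase, Finset.mem_filter, Finset.mem_univ, true_and] at hq
        simp only [Finset.mem_filter, mem_wed]
        exact ⟨⟨⟨hq.2.symm, hq.1.symm⟩, hp⟩, trivial⟩
      · intro w hw
        simp only [Finset.mem_filter] at hw
        simp [← hw.2]
      · intro q hq; rfl
    rw [this, Finset.card_erase_of_mem (by simp), card_bin]

lemma card_wed_snd (s : Finset (Point n d)) :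
    ((wed n d).filter fun w => w.2 ∈ s).card = s.card * (d - 1) := by
  rw [← card_wed_fst]
  refine Finset.card_bij' (fun w _ => w.swap) (fun w _ => w.swap) ?_ ?_ ?_ ?_
  · intro w hw
    simp only [Finset.mem_filter, mem_wed] at hw ⊢
    exact ⟨⟨hw.1.1.symm, hw.1.2.symm⟩, hw.2⟩
  · intro w hw
    simp only [Finset.mem_filter, mem_wed] at hw ⊢
    exact ⟨⟨hw.1.1.symm, hw.1.2.symm⟩, hw.2⟩
  · simp
  · simp

lemma card_wed : (wed n d).card = n * d * (d - 1) := by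
  have := card_wed_fst (Finset.univ : Finset (Point n d))
  simpa using this

lemma card_wed_bin (v : Fin n) :
    ((wed n d).filter fun w => w.1.1 = v).card = d * (d - 1) := by
  have := card_wed_fst (Finset.univ.filter fun p : Point n d => p.1 = v)
  rw [card_bin] at this
  simpa using this

lemma card_wed_f_fst (P : Pairing n d) (v : Fin n) :
    ((wed n d).filter fun w => (P.f w.1).1 = v).card = d * (d - 1) := by
  have := card_wed_fst (Finset.univ.filter fun p : Point n d => (P.f p).1 = v)
  rw [card_f_bin] at this
  simpa using this

lemma card_wed_f_snd (P : Pairing n d) (v : Fin n) :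
    ((wed n d).filter fun w => (P.f w.2).1 = v).card = d * (d - 1) := by
  have := card_wed_snd (Finset.univ.filter fun p : Point n d => (P.f p).1 = v)
  rw [card_f_bin] at this
  simpa using this

lemma card_adj_le {α : Type*} (P : Pairing n d) (T : Finset α) (g : α → Fin n) (m : ℕ)
    (h : ∀ v, (T.filter fun w => g w = v).card ≤ m) (A : Fin n) :
    (T.filter fun w => ∃ z : Point n d, z.1 = A ∧ (P.f z).1 = g w).card ≤ d * m := by
  have : (T.filter fun w => ∃ z : Point n d, z.1 = A ∧ (P.f z).1 = g w) ⊆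
      (Finset.univ.filter fun p : Point n d => p.1 = A).biUnion fun z =>
        T.filter fun w => g w = (P.f z).1 := by
    intro w hw
    simp only [Finset.mem_filter, Finset.mem_biUnion, Finset.mem_univ, true_and] at hw ⊢
    obtain ⟨h1, z, h2, h3⟩ := hw
    exact ⟨z, h2, h1, h3.symm⟩
  refine (Finset.card_le_card this).trans ((Finset.card_biUnion_le_card_mul _ _ m
    (fun z _ => h _)).trans ?_)
  rw [card_bin]

lemma card_reroute (P : Pairing n d) (i : ℕ) (hP : P ∈ SD n d i) (q : Point n d)
    (K : Finset (Point n d)) :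
    n * d ≤ (Finset.univ.filter fun x => Reroute P q x ∧ x ∉ K).card +
      (4 * i + 2 * d + 2 * d ^ 2 + K.card) := by
  obtain ⟨-, -, hD⟩ := (mem_SD_iff P i).1 hP
  have hsub : (Finset.univ : Finset (Point n d)) ⊆
      (Finset.univ.filter fun x => Reroute P q x ∧ x ∉ K) ∪
      ((Finset.univ.filter fun x => Dbl P x) ∪
      ((Finset.univ.filter fun x : Point n d => x.1 = q.1) ∪
      ((Finset.univ.filter fun x : Point n d => (P.f x).1 = (P.f q).1) ∪
      ((Finset.univ.filter fun x : Point n d => ∃ z : Point n d, z.1 = q.1 ∧ (P.f z).1 = x.1) ∪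
      ((Finset.univ.filter fun x : Point n d =>
        ∃ z : Point n d, z.1 = (P.f q).1 ∧ (P.f z).1 = (P.f x).1) ∪ K))))) := by
    intro x _
    simp only [Finset.mem_union, Finset.mem_filter, Finset.mem_univ, true_and]
    unfold Reroute
    by_contra! h
    obtain ⟨h0, h1, h2, h3, h4, h5, h6⟩ := h
    exact h6 (h0 ⟨h1, h2, h3, h4, h5⟩)
  have h := Finset.card_le_card hsub
  have c1 := card_bin (d := d) q.1
  have c2 := card_f_bin P (P.f q).1
  have c3 := card_adj_le P (Finset.univ : Finset (Point n d)) (fun x => x.1) d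
    (fun v => (card_bin v).le) q.1
  have c4 := card_adj_le P (Finset.univ : Finset (Point n d)) (fun x => (P.f x).1) d
    (fun v => (card_f_bin P v).le) (P.f q).1
  have c0 : (Finset.univ : Finset (Point n d)).card = n * d := by simp
  rw [c0] at h
  refine h.trans ((Finset.card_union_le _ _).trans (Nat.add_le_add_left ?_ _))
  refine ((Finset.card_union_le _ _).trans (Nat.add_le_add_left
    ((Finset.card_union_le _ _).trans (Nat.add_le_add_left
    ((Finset.card_union_le _ _).trans (Nat.add_le_add_left
    ((Finset.card_union_le _ _).trans (Nat.add_le_add_left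
    (Finset.card_union_le _ _) _)) _)) _)) _)).trans ?_
  nlinarith

lemma card_relocate (P : Pairing n d) (i : ℕ) (hP : P ∈ SD n d i) (p : Point n d) :
    n * d * (d - 1) ≤ ((wed n d).filter fun w => Relocate P p w).card +
      (8 * i * (d - 1) + 4 * (d * (d - 1)) + 3 * (d * (d * (d - 1)))) := by
  obtain ⟨-, -, hD⟩ := (mem_SD_iff P i).1 hP
  have hsub : wed n d ⊆
      ((wed n d).filter fun w => Relocate P p w) ∪
      (((wed n d).filter fun w => w.1 ∈ Finset.univ.filter fun x => Dbl P x) ∪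
      (((wed n d).filter fun w => w.2 ∈ Finset.univ.filter fun x => Dbl P x) ∪
      (((wed n d).filter fun w => w.1.1 = p.1) ∪
      (((wed n d).filter fun w => w.1.1 = (P.f p).1) ∪
      (((wed n d).filter fun w => (P.f w.1).1 = p.1) ∪
      (((wed n d).filter fun w => (P.f w.2).1 = p.1) ∪
      (((wed n d).filter fun w =>
        ∃ z : Point n d, z.1 = (P.f p).1 ∧ (P.f z).1 = w.1.1) ∪
      (((wed n d).filter fun w =>
        ∃ z : Point n d, z.1 = p.1 ∧ (P.f z).1 = (P.f w.1).1) ∪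
      ((wed n d).filter fun w =>
        ∃ z : Point n d, z.1 = p.1 ∧ (P.f z).1 = (P.f w.2).1))))))))) := by
    intro w hw
    simp only [Finset.mem_union, Finset.mem_filter, Finset.mem_univ, true_and, hw]
    unfold Relocate
    by_contra! h
    obtain ⟨h0, h1, h2, h3, h4, h5, h6, h7, h8, h9⟩ := h
    obtain ⟨z, hz1, hz2⟩ := h0 h1 h2 h3 h4 h5 h6 h7 h8
    exact h9 z hz1 hz2
  have h := Finset.card_le_card hsub
  have c1 := card_wed_fst (Finset.univ.filter fun x => Dbl P x)
  have c2 := card_wed_snd (Finset.univ.filter fun x => Dbl P x)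
  have c3 := card_wed_bin (d := d) p.1
  have c4 := card_wed_bin (d := d) (P.f p).1
  have c5 := card_wed_f_fst P p.1
  have c6 := card_wed_f_snd P p.1
  have c7 := card_adj_le P (wed n d) (fun w => w.1.1) _ (fun v => (card_wed_bin v).le) (P.f p).1
  have c8 := card_adj_le P (wed n d) (fun w => (P.f w.1).1) _
    (fun v => (card_wed_f_fst P v).le) p.1
  have c9 := card_adj_le P (wed n d) (fun w => (P.f w.2).1) _
    (fun v => (card_wed_f_snd P v).le) p.1
  rw [card_wed] at h
  rw [hD] at c1 c2
  refine h.trans ((Finset.card_union_le _ _).trans (Nat.add_le_add_left ?_ _))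
  refine ((Finset.card_union_le _ _).trans (Nat.add_le_add c1.le
    ((Finset.card_union_le _ _).trans (Nat.add_le_add c2.le
    ((Finset.card_union_le _ _).trans (Nat.add_le_add c3.le
    ((Finset.card_union_le _ _).trans (Nat.add_le_add c4.le
    ((Finset.card_union_le _ _).trans (Nat.add_le_add c5.le
    ((Finset.card_union_le _ _).trans (Nat.add_le_add c6.le
    ((Finset.card_union_le _ _).trans (Nat.add_le_add c7
    ((Finset.card_union_le _ _).trans (Nat.add_le_add c8 c9)))))))))))))))).trans ?_
  apply le_of_eq
  ring

lemma switch_aux {α β : Type*} (bin : α → β) (f F : α → α) (p1 p2 p3 p4 p5 p6 p7 p8 : α)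
    (f1 : f p1 = p2) (f3 : f p3 = p4) (f5 : f p5 = p6) (f7 : f p7 = p8)
    (F1 : F p1 = p5) (F3 : F p3 = p7) (F2 : F p2 = p6) (F4 : F p4 = p8)
    (F5 : F p5 = p1) (F7 : F p7 = p3) (F6 : F p6 = p2) (F8 : F p8 = p4)
    (F0 : ∀ z, z = p1 ∨ z = p2 ∨ z = p3 ∨ z = p4 ∨ z = p5 ∨ z = p6 ∨ z = p7 ∨ z = p8 ∨ F z = f z)
    (b13 : bin p1 = bin p3) (b24 : bin p2 = bin p4)
    (m12 : ∀ q, bin q = bin p1 → bin (f q) = bin p2 → q = p1 ∨ q = p3)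
    (m56 : ∀ q, bin q = bin p5 → bin (f q) = bin p6 → q = p5)
    (m78 : ∀ q, bin q = bin p7 → bin (f q) = bin p8 → q = p7)
    (t1 : ∀ q, bin q = bin p1 → bin (f q) ≠ bin p5)
    (t2 : ∀ q, bin q = bin p1 → bin (f q) ≠ bin p7)
    (t3 : ∀ q, bin q = bin p2 → bin (f q) ≠ bin p6)
    (t4 : ∀ q, bin q = bin p2 → bin (f q) ≠ bin p8)
    (hb : [bin p1, bin p2, bin p5, bin p6, bin p7, bin p8].Pairwise (· ≠ ·)) (q : α) :
    (q ≠ p1 → bin p1 = bin q → bin (F p1) ≠ bin (F q)) ∧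
    (q ≠ p3 → bin p3 = bin q → bin (F p3) ≠ bin (F q)) ∧
    (q ≠ p2 → bin p2 = bin q → bin (F p2) ≠ bin (F q)) ∧
    (q ≠ p4 → bin p4 = bin q → bin (F p4) ≠ bin (F q)) ∧
    (bin q = bin p1 → bin (F q) ≠ bin p2) ∧
    (bin q = bin (F p1) → bin (F q) ≠ bin (F p2)) ∧
    (bin q = bin (F p3) → bin (F q) ≠ bin (F p4)) := by
  have h0 := F0 q
  have a1 := m12 q
  have a2 := m56 q
  have a3 := m78 q
  have a4 := t1 q
  have a5 := t2 q
  have a6 := t3 q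
  have a7 := t4 q
  simp only [List.pairwise_cons, List.mem_cons, List.not_mem_nil, or_false, forall_eq_or_imp,
    forall_eq] at hb
  clear m12 m56 m78 t1 t2 t3 t4 F0
  rcases h0 with h | h | h | h | h | h | h | h | h <;> grind

/-- Some pair of `P` joins the bins `u` and `v`. -/
def Cross (P : Pairing n d) (u v : Fin n) : Prop := ∃ q : Point n d, q.1 = u ∧ (P.f q).1 = v

/-- The two wedges may be the outcome of a class A switching. -/
def Good (P : Pairing n d) (t : (Point n d × Point n d) × (Point n d × Point n d)) : Prop :=
  ¬ Dbl P t.1.1 ∧ ¬ Dbl P t.1.2 ∧ ¬ Dbl P t.2.1 ∧ ¬ Dbl P t.2.2 ∧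
  ¬ Cross P t.1.1.1 t.2.1.1 ∧ ¬ Cross P (P.f t.1.1).1 (P.f t.2.1).1 ∧
  ¬ Cross P (P.f t.1.2).1 (P.f t.2.2).1

lemma not_cross_of_mult {P : Pairing n d} {u v : Fin n} (h : ¬ 1 ≤ mult P u v) (q : Point n d)
    (hq : q.1 = u) : (P.f q).1 ≠ v := by
  rw [mult_pos_iff] at h
  push Not at h
  exact h q hq

lemma typeIA_good (P : Pairing n d) (s : DSwitch n d) (h : IsTypeIA P s) :
    ((s.p1, s.p3) ∈ wed n d ∧ (s.p2, s.p4) ∈ wed n d) ∧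
      Good (dResult P s) ((s.p1, s.p3), (s.p2, s.p4)) ∧
      (dResult P s).f s.p1 = s.p5 ∧ (dResult P s).f s.p3 = s.p7 ∧
      (dResult P s).f s.p2 = s.p6 ∧ (dResult P s).f s.p4 = s.p8 := by
  obtain ⟨⟨⟨f1, f3, f5, f7, b13, b24, n13, m12, m56, m78, hb⟩, -, -⟩, hj⟩ := h
  have hb' := hb
  simp only [List.pairwise_cons, List.mem_cons, List.not_mem_nil, or_false, forall_eq_or_imp,
    forall_eq] at hb
  unfold joinedCount targets at hj
  rw [List.countP_eq_zero] at hj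
  simp only [List.mem_cons, List.not_mem_nil, or_false, forall_eq_or_imp, forall_eq,
    decide_eq_true_eq] at hj
  obtain ⟨j1, j2, j3, j4⟩ := hj
  have i0 := P.invol
  have f2 : P.f s.p2 = s.p1 := by rw [← f1, i0]
  have f4 : P.f s.p4 = s.p3 := by rw [← f3, i0]
  have f6 : P.f s.p6 = s.p5 := by rw [← f5, i0]
  have f8 : P.f s.p8 = s.p7 := by rw [← f7, i0]
  have n24 : s.p2 ≠ s.p4 := by intro hh; apply n13; rw [← f2, ← f4, hh]
  have hF : ∀ z, (dResult P s).f z = dtau s (P.f ((dtau s).symm z)) := fun z => rfl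
  have hsymm : ∀ z, (dtau s).symm z =
      Equiv.swap s.p4 s.p7 (Equiv.swap s.p2 s.p5 z) := by
    intro z; simp [dtau]
  have htau : ∀ z, dtau s z = Equiv.swap s.p2 s.p5 (Equiv.swap s.p4 s.p7 z) := by
    intro z; simp [dtau]
  have hF' : ∀ z, (dResult P s).f z = Equiv.swap s.p2 s.p5 (Equiv.swap s.p4 s.p7
      (P.f (Equiv.swap s.p4 s.p7 (Equiv.swap s.p2 s.p5 z)))) := by
    intro z; rw [hF, hsymm, htau]
  clear hF hsymm htau
  set F := (dResult P s).f with hFdef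
  obtain ⟨p1, p2, p3, p4, p5, p6, p7, p8⟩ := s
  simp only at *
  have F1 : F p1 = p5 := by rw [hF']; simp only [Equiv.swap_apply_def]; grind
  have F2 : F p2 = p6 := by rw [hF']; simp only [Equiv.swap_apply_def]; grind
  have F3 : F p3 = p7 := by rw [hF']; simp only [Equiv.swap_apply_def]; grind
  have F4 : F p4 = p8 := by rw [hF']; simp only [Equiv.swap_apply_def]; grind
  have i1 := (dResult P ⟨p1, p2, p3, p4, p5, p6, p7, p8⟩).invol
  rw [← hFdef] at i1
  have F5 : F p5 = p1 := by rw [← F1, i1]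
  have F6 : F p6 = p2 := by rw [← F2, i1]
  have F7 : F p7 = p3 := by rw [← F3, i1]
  have F8 : F p8 = p4 := by rw [← F4, i1]
  have F0 : ∀ z, z = p1 ∨ z = p2 ∨ z = p3 ∨ z = p4 ∨ z = p5 ∨ z = p6 ∨ z = p7 ∨ z = p8 ∨
      F z = P.f z := by
    intro z
    by_contra! hz
    obtain ⟨z1, z2, z3, z4, z5, z6, z7, z8, z9⟩ := hz
    apply z9
    have w2 : P.f z ≠ p2 := by rintro hz; have := i0 z; rw [hz, f2] at this; exact z1 this.symm
    have w4 : P.f z ≠ p4 := by rintro hz; have := i0 z; rw [hz, f4] at this; exact z3 this.symm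
    have w5 : P.f z ≠ p5 := by rintro hz; have := i0 z; rw [hz, f5] at this; exact z6 this.symm
    have w7 : P.f z ≠ p7 := by rintro hz; have := i0 z; rw [hz, f7] at this; exact z8 this.symm
    rw [hF', Equiv.swap_apply_of_ne_of_ne z2 z5, Equiv.swap_apply_of_ne_of_ne z4 z7,
      Equiv.swap_apply_of_ne_of_ne w4 w7, Equiv.swap_apply_of_ne_of_ne w2 w5]
  have M12 : ∀ q : Point n d, q.1 = p1.1 → (P.f q).1 = p2.1 → q = p1 ∨ q = p3 := by
    intro q q1 q2
    by_contra! hq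
    have : 2 < mult P p1.1 p2.1 := by
      unfold mult
      rw [Finset.two_lt_card]
      exact ⟨p1, by simp [f1], p3, by simp [f3, b13, b24], q, by simp [q1, q2],
        n13, hq.1.symm, hq.2.symm⟩
    omega
  have M1 : ∀ p p' : Point n d, P.f p = p' → mult P p.1 p'.1 = 1 →
      ∀ q : Point n d, q.1 = p.1 → (P.f q).1 = p'.1 → q = p := by
    intro p p' hp hm q q1 q2
    by_contra! hq
    have : 1 < mult P p.1 p'.1 := by
      unfold mult
      rw [Finset.one_lt_card]
      exact ⟨p, by simp [hp], q, by simp [q1, q2], hq.symm⟩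
    omega
  have key := switch_aux Prod.fst P.f F p1 p2 p3 p4 p5 p6 p7 p8 f1 f3 f5 f7 F1 F3 F2 F4
    F5 F7 F6 F8 F0 b13 b24 M12 (M1 _ _ f5 m56) (M1 _ _ f7 m78) (not_cross_of_mult j1)
    (not_cross_of_mult j2) (not_cross_of_mult j3) (not_cross_of_mult j4) hb'
  refine ⟨⟨(mem_wed _).2 ⟨b13, n13⟩, (mem_wed _).2 ⟨b24, n24⟩⟩, ?_, F1, F3, F2, F4⟩
  unfold Good Dbl Par Cross
  rw [← hFdef]
  push Not
  exact ⟨fun q h1 h2 => (key q).1 h1 h2, fun q h1 h2 => (key q).2.1 h1 h2,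
    fun q h1 h2 => (key q).2.2.1 h1 h2, fun q h1 h2 => (key q).2.2.2.1 h1 h2,
    fun q h1 => (key q).2.2.2.2.1 h1, fun q h1 => (key q).2.2.2.2.2.1 h1,
    fun q h1 => (key q).2.2.2.2.2.2 h1⟩

lemma bA_le (m : ℕ) (P : Pairing n d) :
    bA m P ≤ ((wed n d ×ˢ wed n d).filter fun t => Good P t).card := by
  unfold bA
  have key : ∀ q : {q : Pairing n d × DSwitch n d //
      q.1 ∈ Phi1 n d m ∧ IsTypeIA q.1 q.2 ∧ dResult q.1 q.2 = P},
      ((q.1.2.p1, q.1.2.p3), (q.1.2.p2, q.1.2.p4)) ∈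
        (wed n d ×ˢ wed n d).filter fun t => Good P t := by
    rintro ⟨⟨P', s⟩, h1, h2, rfl⟩
    have := typeIA_good P' s h2
    rw [Finset.mem_filter, Finset.mem_product]
    exact ⟨this.1, this.2.1⟩
  refine (Nat.card_le_card_of_injective (β := {t // t ∈
    (wed n d ×ˢ wed n d).filter fun t => Good P t}) (fun q => ⟨_, key q⟩) ?_).trans
    (Nat.card_eq_finsetCard _).le
  rintro ⟨⟨P1, s1⟩, h1, h2, h3⟩ ⟨⟨P2, s2⟩, k1, k2, k3⟩ h
  simp only [Subtype.mk.injEq, Prod.mk.injEq] at h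
  obtain ⟨⟨e1, e2⟩, e3, e4⟩ := h
  simp only at h2 h3 k2 k3
  have a1 := (typeIA_good P1 s1 h2).2.2
  have a2 := (typeIA_good P2 s2 k2).2.2
  rw [h3] at a1
  rw [k3] at a2
  have hs : s1 = s2 := by
    obtain ⟨b1, b2, b3, b4⟩ := a1
    obtain ⟨c1, c2, c3, c4⟩ := a2
    rw [e1, c1] at b1
    rw [e2, c2] at b2
    rw [e3, c3] at b3
    rw [e4, c4] at b4
    cases s1; cases s2
    simp_all
  subst hs
  have hP : P1 = P2 := by
    rw [← conj_symm_conj P1 (dtau s1), ← conj_symm_conj P2 (dtau s1)]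
    unfold dResult at h3 k3
    rw [h3, k3]
  subst hP
  rfl

/-- The three bins attached to a wedge: its own bin and those of its two mates. -/
def bn (P : Pairing n d) : Fin 3 → Point n d × Point n d → Fin n
  | 0, w => w.1.1
  | 1, w => (P.f w.1).1
  | 2, w => (P.f w.2).1

lemma card_bn (P : Pairing n d) (k : Fin 3) (v : Fin n) :
    ((wed n d).filter fun w => bn P k w = v).card = d * (d - 1) := by
  fin_cases k
  · exact card_wed_bin v
  · exact card_wed_f_fst P v
  · exact card_wed_f_snd P v

/-- The points of `A` whose pair leads from bin `u` to bin `v`. -/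
def crossS (P : Pairing n d) (A : Finset (Point n d)) (u v : Fin n) : Finset (Point n d) :=
  A.filter fun q => q.1 = u ∧ (P.f q).1 = v

lemma sum_crossS (P : Pairing n d) (A : Finset (Point n d)) (k : Fin 3) :
    ∑ t ∈ wed n d ×ˢ wed n d, (crossS P A (bn P k t.1) (bn P k t.2)).card =
      A.card * (d * (d - 1)) ^ 2 := by
  unfold crossS
  simp only [Finset.card_filter]
  rw [Finset.sum_comm, Finset.sum_congr rfl (g := fun _ => (d * (d - 1)) ^ 2)]
  · simp
  · intro q _
    rw [← Finset.card_filter, sq]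
    nth_rw 1 [← card_bn P k q.1]
    rw [← card_bn P k (P.f q).1, ← Finset.card_product, ← Finset.filter_product]
    congr 1
    ext t
    simp [eq_comm]

lemma sum_crossS_right (P : Pairing n d) (A : Finset (Point n d)) (k : Fin 3) (u : Fin n) :
    ∑ w ∈ wed n d, (crossS P A u (bn P k w)).card ≤ d * (d * (d - 1)) := by
  unfold crossS
  simp only [Finset.card_filter]
  rw [Finset.sum_comm]
  calc _ = ∑ q ∈ A.filter fun q => q.1 = u, d * (d - 1) := by
        rw [Finset.sum_filter]
        refine Finset.sum_congr rfl fun q _ => ?_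
        split_ifs with h
        · rw [← card_bn P k (P.f q).1, Finset.card_filter]
          refine Finset.sum_congr rfl fun w _ => ?_
          simp [h, eq_comm]
        · simp [h]
    _ ≤ _ := by
        rw [Finset.sum_const, smul_eq_mul]
        refine Nat.mul_le_mul_right _ ?_
        refine le_trans ?_ (card_bin (d := d) u).le
        exact Finset.card_le_card (Finset.filter_subset_filter _ (Finset.subset_univ _))

lemma sum_crossS_left (P : Pairing n d) (A : Finset (Point n d)) (k : Fin 3) (v : Fin n) :
    ∑ w ∈ wed n d, (crossS P A (bn P k w) v).card ≤ d * (d * (d - 1)) := by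
  unfold crossS
  simp only [Finset.card_filter]
  rw [Finset.sum_comm]
  calc _ = ∑ q ∈ A.filter fun q => (P.f q).1 = v, d * (d - 1) := by
        rw [Finset.sum_filter]
        refine Finset.sum_congr rfl fun q _ => ?_
        split_ifs with h
        · rw [← card_bn P k q.1, Finset.card_filter]
          refine Finset.sum_congr rfl fun w _ => ?_
          simp [h, eq_comm]
        · simp [h]
    _ ≤ _ := by
        rw [Finset.sum_const, smul_eq_mul]
        refine Nat.mul_le_mul_right _ ?_
        refine le_trans ?_ (card_f_bin P v).le
        exact Finset.card_le_card (Finset.filter_subset_filter _ (Finset.subset_univ _))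

/-- The points on single edges. -/
noncomputable def sgl (P : Pairing n d) : Finset (Point n d) := Finset.univ.filter fun p => ¬ Dbl P p

lemma card_sgl (P : Pairing n d) (i : ℕ) (hP : P ∈ SD n d i) :
    (sgl P).card + 4 * i = n * d := by
  obtain ⟨-, -, h⟩ := (mem_SD_iff P i).1 hP
  rw [← h, add_comm]
  unfold sgl
  rw [Finset.card_filter_add_card_filter_not]
  simp

lemma card_crossS_sgl_le_one (P : Pairing n d) (u v : Fin n) :
    (crossS P (sgl P) u v).card ≤ 1 := by
  rw [Finset.card_le_one]
  intro a ha b hb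
  simp only [crossS, sgl, Finset.mem_filter, Finset.mem_univ, true_and] at ha hb
  by_contra h
  exact ha.1 ⟨b, fun hh => h hh.symm, by rw [ha.2.1, hb.2.1], by rw [ha.2.2, hb.2.2]⟩

/-- Number of end points of the wedge lying on double edges. -/
noncomputable def nd2 (P : Pairing n d) (w : Point n d × Point n d) : ℕ :=
  (if Dbl P w.1 then 1 else 0) + (if Dbl P w.2 then 1 else 0)

/-- The wedges with both pairs on double edges. -/
noncomputable def bothS (P : Pairing n d) : Finset (Point n d × Point n d) :=
  (wed n d).filter fun w => Dbl P w.1 ∧ Dbl P w.2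

lemma sum_nd2 (P : Pairing n d) (i : ℕ) (hP : P ∈ SD n d i) :
    ∑ w ∈ wed n d, nd2 P w = 8 * i * (d - 1) := by
  obtain ⟨-, -, h⟩ := (mem_SD_iff P i).1 hP
  have c1 := card_wed_fst (Finset.univ.filter fun x => Dbl P x)
  have c2 := card_wed_snd (Finset.univ.filter fun x => Dbl P x)
  rw [h] at c1 c2
  simp only [Finset.mem_filter, Finset.mem_univ, true_and] at c1 c2
  unfold nd2
  rw [Finset.sum_add_distrib, ← Finset.card_filter, ← Finset.card_filter, c1, c2]
  ring

/-- The wedges' bins are distinct from each other, and the mates of the first are in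
different bins. -/
def Sep (P : Pairing n d) (t : (Point n d × Point n d) × (Point n d × Point n d)) : Prop :=
  (∀ j k, bn P j t.1 ≠ bn P k t.2) ∧ bn P 1 t.1 ≠ bn P 2 t.1

/-- The number of single pairs joining the `k`-th bins. -/
noncomputable def cr (P : Pairing n d) (k : Fin 3)
    (t : (Point n d × Point n d) × (Point n d × Point n d)) : ℕ :=
  (crossS P (sgl P) (bn P k t.1) (bn P k t.2)).card

lemma cr_eq_zero (P : Pairing n d) (k : Fin 3)
    (t : (Point n d × Point n d) × (Point n d × Point n d))
    (h : ¬ Cross P (bn P k t.1) (bn P k t.2)) : cr P k t = 0 := by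
  unfold cr crossS
  rw [Finset.card_eq_zero, Finset.filter_eq_empty_iff]
  intro q _ hq
  exact h ⟨q, hq⟩

lemma bonferroni_aux (a1 a2 b1 b2 c0 c1 c2 G N : ℕ) (h1 : a1 ≤ 1) (h2 : a2 ≤ 1) (h3 : b1 ≤ 1)
    (h4 : b2 ≤ 1) (h5 : c0 ≤ 1) (h6 : c1 ≤ 1) (h7 : c2 ≤ 1) (hN : N ≤ 1) (hG : G ≤ 1)
    (hG0 : G = 1 → a1 = 0 ∧ a2 = 0 ∧ b1 = 0 ∧ b2 = 0 ∧ c0 = 0 ∧ c1 = 0 ∧ c2 = 0) :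
    G + ((a1 + a2) + (b1 + b2) + (c0 + c1 + c2)) ≤
      1 + a1 * a2 + b1 * b2 + (a1 + a2) * (b1 + b2) + ((a1 + a2) * (c0 + c1 + c2) +
        (b1 + b2) * (c0 + c1 + c2)) + N * (c0 * c1 + c0 * c2 + c1 * c2) + 3 * (1 - N) := by
  interval_cases G
  · have : 3 * (1 - N) + N * (c0 * c1 + c0 * c2 + c1 * c2) ≥ c0 * c1 + c0 * c2 + c1 * c2 := by
      interval_cases N
      · have := Nat.mul_le_mul h5 h6
        have := Nat.mul_le_mul h5 h7
        have := Nat.mul_le_mul h6 h7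
        omega
      · omega
    suffices h : ((a1 + a2) + (b1 + b2) + (c0 + c1 + c2)) ≤
      1 + a1 * a2 + b1 * b2 + (a1 + a2) * (b1 + b2) + ((a1 + a2) * (c0 + c1 + c2) +
        (b1 + b2) * (c0 + c1 + c2)) + (c0 * c1 + c0 * c2 + c1 * c2) by omega
    interval_cases a1 <;> interval_cases a2 <;> interval_cases b1 <;> interval_cases b2 <;>
      interval_cases c0 <;> interval_cases c1 <;> interval_cases c2 <;> simp
  · obtain ⟨rfl, rfl, rfl, rfl, rfl, rfl, rfl⟩ := hG0 rfl
    simp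

lemma bonferroni (P : Pairing n d) (t : (Point n d × Point n d) × (Point n d × Point n d)) :
    (if Good P t then 1 else 0) + (nd2 P t.1 + nd2 P t.2 + (cr P 0 t + cr P 1 t + cr P 2 t)) ≤
      1 + (if Dbl P t.1.1 ∧ Dbl P t.1.2 then 1 else 0) +
        (if Dbl P t.2.1 ∧ Dbl P t.2.2 then 1 else 0) + nd2 P t.1 * nd2 P t.2 +
        (nd2 P t.1 * (cr P 0 t + cr P 1 t + cr P 2 t) +
          nd2 P t.2 * (cr P 0 t + cr P 1 t + cr P 2 t)) +
        (if Sep P t then cr P 0 t * cr P 1 t + cr P 0 t * cr P 2 t + cr P 1 t * cr P 2 t else 0) +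
        3 * (if ¬ Sep P t then 1 else 0) := by
  have key := bonferroni_aux (if Dbl P t.1.1 then 1 else 0) (if Dbl P t.1.2 then 1 else 0)
    (if Dbl P t.2.1 then 1 else 0) (if Dbl P t.2.2 then 1 else 0) (cr P 0 t) (cr P 1 t) (cr P 2 t)
    (if Good P t then 1 else 0) (if Sep P t then 1 else 0) (by split_ifs <;> simp)
    (by split_ifs <;> simp) (by split_ifs <;> simp) (by split_ifs <;> simp)
    (card_crossS_sgl_le_one _ _ _) (card_crossS_sgl_le_one _ _ _)
    (card_crossS_sgl_le_one _ _ _) (by split_ifs <;> simp) (by split_ifs <;> simp)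
    (by
      intro h
      split_ifs at h with hg
      · obtain ⟨g1, g2, g3, g4, g5, g6, g7⟩ := hg
        rw [if_neg g1, if_neg g2, if_neg g3, if_neg g4]
        exact ⟨rfl, rfl, rfl, rfl, cr_eq_zero P 0 t g5, cr_eq_zero P 1 t g6,
          cr_eq_zero P 2 t g7⟩)
  have e1 : ∀ a b : Prop, (if a then 1 else 0) * (if b then 1 else 0) =
      (if a ∧ b then 1 else 0) := by
    intro a b; by_cases a <;> by_cases b <;> simp [*]
  rw [e1, e1] at key
  unfold nd2
  refine key.trans (le_of_eq ?_)
  by_cases hs : Sep P t <;> simp [hs]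

lemma card_par_wed_le (P : Pairing n d) (i : ℕ) (hP : P ∈ SD n d i) :
    ((wed n d).filter fun w => Par P w.1 w.2).card ≤ 4 * i := by
  obtain ⟨-, hm, h⟩ := (mem_SD_iff P i).1 hP
  rw [← h]
  refine Finset.card_le_card_of_injOn (fun w => w.1) ?_ ?_
  · intro w hw
    simp only [Finset.coe_filter, Set.mem_ofPred_eq, mem_wed] at hw
    simp only [Finset.coe_filter, Finset.mem_univ, true_and, Set.mem_ofPred_eq]
    exact ⟨w.2, hw.1.2.symm, hw.2⟩
  · rintro ⟨a, b⟩ hw ⟨a', b'⟩ hw' hh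
    simp only [Finset.coe_filter, Set.mem_ofPred_eq, mem_wed] at hw hw'
    simp only at hh
    subst hh
    have := hm a b b' hw.2 hw'.2
    have h1 := hw.1.2
    have h2 := hw'.1.2
    simp_all

lemma card_not_sep_le (P : Pairing n d) (i : ℕ) (hP : P ∈ SD n d i) :
    ((wed n d ×ˢ wed n d).filter fun t => ¬ Sep P t).card ≤
      n * d * (d - 1) * (9 * (d * (d - 1)) + 4 * i) := by
  have hsub : ((wed n d ×ˢ wed n d).filter fun t => ¬ Sep P t) ⊆
      ((Finset.univ : Finset (Fin 3 × Fin 3)).biUnion fun jk =>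
        (wed n d ×ˢ wed n d).filter fun t => bn P jk.2 t.2 = bn P jk.1 t.1) ∪
      ((wed n d).filter fun w => Par P w.1 w.2) ×ˢ wed n d := by
    intro t ht
    rw [Finset.mem_filter] at ht
    simp only [Finset.mem_filter, Finset.mem_product, Finset.mem_union, Finset.mem_biUnion,
      Finset.mem_univ, true_and, mem_wed] at ht ⊢
    unfold Sep at ht
    obtain ⟨⟨⟨h1, h2⟩, h3⟩, h4⟩ := ht
    by_cases h5 : bn P 1 t.1 = bn P 2 t.1
    · exact Or.inr ⟨⟨⟨h1, h2⟩, h1, h5⟩, h3⟩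
    · left
      have : ¬ ∀ j k, bn P j t.1 ≠ bn P k t.2 := fun hh => h4 ⟨hh, h5⟩
      push Not at this
      obtain ⟨j, k, hjk⟩ := this
      exact ⟨(j, k), ⟨⟨h1, h2⟩, h3⟩, hjk.symm⟩
  have hjk : ∀ jk : Fin 3 × Fin 3,
      ((wed n d ×ˢ wed n d).filter fun t => bn P jk.2 t.2 = bn P jk.1 t.1).card =
        n * d * (d - 1) * (d * (d - 1)) := by
    intro jk
    rw [Finset.card_filter, Finset.sum_product, Finset.sum_congr rfl
      (g := fun _ => d * (d - 1))]
    · rw [Finset.sum_const, card_wed, smul_eq_mul]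
    · intro w _
      rw [← Finset.card_filter]
      convert card_bn P jk.2 (bn P jk.1 w)
  refine (Finset.card_le_card hsub).trans ((Finset.card_union_le _ _).trans ?_)
  rw [Finset.card_product, card_wed]
  have h1 := Finset.card_biUnion_le_card_mul (Finset.univ : Finset (Fin 3 × Fin 3))
    (fun jk => (wed n d ×ˢ wed n d).filter fun t => bn P jk.2 t.2 = bn P jk.1 t.1) _
    (fun jk _ => (hjk jk).le)
  have h2 := Nat.mul_le_mul_right (n * d * (d - 1)) (card_par_wed_le P i hP)
  refine (Nat.add_le_add h1 h2).trans (le_of_eq ?_)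
  simp
  ring

lemma sum_pairs_fst {α : Type*} (s : Finset α) (f : α → ℕ) :
    ∑ t ∈ s ×ˢ s, f t.1 = s.card * ∑ w ∈ s, f w := by
  rw [Finset.sum_product, Finset.mul_sum]
  refine Finset.sum_congr rfl fun w _ => ?_
  simp

lemma sum_pairs_snd {α : Type*} (s : Finset α) (f : α → ℕ) :
    ∑ t ∈ s ×ˢ s, f t.2 = s.card * ∑ w ∈ s, f w := by
  rw [Finset.sum_product]
  simp

/-- The wedges whose two pairs lie on different double edges. -/
noncomputable def dblWed (P : Pairing n d) : Finset (Point n d × Point n d) :=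
  (wed n d).filter fun w => Dbl P w.1 ∧ Dbl P w.2 ∧ ¬ Par P w.1 w.2

lemma card_bothS_le (P : Pairing n d) (i : ℕ) (hP : P ∈ SD n d i) :
    (bothS P).card ≤ 4 * i + (dblWed P).card := by
  refine le_trans (Finset.card_le_card (t := ((wed n d).filter fun w => Par P w.1 w.2) ∪ dblWed P)
    ?_) ((Finset.card_union_le _ _).trans (Nat.add_le_add_right (card_par_wed_le P i hP) _))
  intro w hw
  simp only [bothS, dblWed, Finset.mem_filter, Finset.mem_union] at hw ⊢
  tauto

lemma sum_nd2_cr_fst (P : Pairing n d) (i : ℕ) (hP : P ∈ SD n d i) (k : Fin 3) :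
    ∑ t ∈ wed n d ×ˢ wed n d, nd2 P t.1 * cr P k t ≤ 8 * i * (d - 1) * (d * (d * (d - 1))) := by
  rw [Finset.sum_product, ← sum_nd2 P i hP, Finset.sum_mul]
  refine Finset.sum_le_sum fun w _ => ?_
  simp only [← Finset.mul_sum]
  refine Nat.mul_le_mul_left _ ?_
  unfold cr
  exact sum_crossS_right P (sgl P) k (bn P k w)

lemma sum_nd2_cr_snd (P : Pairing n d) (i : ℕ) (hP : P ∈ SD n d i) (k : Fin 3) :
    ∑ t ∈ wed n d ×ˢ wed n d, nd2 P t.2 * cr P k t ≤ 8 * i * (d - 1) * (d * (d * (d - 1))) := by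
  rw [Finset.sum_product_right, ← sum_nd2 P i hP, Finset.sum_mul]
  refine Finset.sum_le_sum fun w _ => ?_
  simp only [← Finset.mul_sum]
  refine Nat.mul_le_mul_left _ ?_
  unfold cr
  exact sum_crossS_left P (sgl P) k (bn P k w)

/-- Number of separated pairs of wedges with single pairs joining both the `j`-th and the
`k`-th bins, counted with multiplicity. -/
noncomputable def crPairs (P : Pairing n d) (j k : Fin 3) : ℕ :=
  ∑ t ∈ (wed n d ×ˢ wed n d).filter fun t => Sep P t, cr P j t * cr P k t

lemma card_good_le (P : Pairing n d) (i : ℕ) (hP : P ∈ SD n d i) :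
    ((wed n d ×ˢ wed n d).filter fun t => Good P t).card +
      (2 * (n * d * (d - 1) * (8 * i * (d - 1))) + 3 * ((sgl P).card * (d * (d - 1)) ^ 2)) ≤
    (n * d * (d - 1)) ^ 2 + 2 * (n * d * (d - 1) * (4 * i + (dblWed P).card)) +
      (8 * i * (d - 1)) ^ 2 + 6 * (8 * i * (d - 1) * (d * (d * (d - 1)))) +
      (crPairs P 0 1 + crPairs P 0 2 + crPairs P 1 2) +
      3 * (n * d * (d - 1) * (9 * (d * (d - 1)) + 4 * i)) := by
  have h := Finset.sum_le_sum (s := wed n d ×ˢ wed n d) fun t _ => bonferroni P t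
  simp only [Finset.sum_add_distrib, ← Finset.mul_sum, mul_add] at h
  have s1 := sum_pairs_fst (wed n d) (nd2 P)
  have s2 := sum_pairs_snd (wed n d) (nd2 P)
  have s3 := sum_pairs_fst (wed n d) (fun w => if Dbl P w.1 ∧ Dbl P w.2 then 1 else 0)
  have s4 := sum_pairs_snd (wed n d) (fun w => if Dbl P w.1 ∧ Dbl P w.2 then 1 else 0)
  rw [sum_nd2 P i hP, card_wed] at s1 s2
  rw [← Finset.card_filter (fun w : Point n d × Point n d => Dbl P w.1 ∧ Dbl P w.2), card_wed]
    at s3 s4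
  have hb := Nat.mul_le_mul_left (n * d * (d - 1)) (card_bothS_le P i hP)
  unfold bothS at hb
  have s5 : ∑ t ∈ wed n d ×ˢ wed n d, nd2 P t.1 * nd2 P t.2 = (8 * i * (d - 1)) ^ 2 := by
    rw [Finset.sum_product, sq]
    nth_rw 1 [← sum_nd2 P i hP]
    rw [← sum_nd2 P i hP, Finset.sum_mul_sum]
  have s6 : ∀ k, ∑ t ∈ wed n d ×ˢ wed n d, cr P k t = (sgl P).card * (d * (d - 1)) ^ 2 :=
    fun k => sum_crossS P _ k
  have s7 := sum_nd2_cr_fst P i hP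
  have s8 := sum_nd2_cr_snd P i hP
  have s9 : ∑ t ∈ wed n d ×ˢ wed n d, (if Sep P t then
      cr P 0 t * cr P 1 t + cr P 0 t * cr P 2 t + cr P 1 t * cr P 2 t else 0) =
      crPairs P 0 1 + crPairs P 0 2 + crPairs P 1 2 := by
    unfold crPairs
    rw [← Finset.sum_filter, Finset.sum_add_distrib, Finset.sum_add_distrib]
  have s10 := card_not_sep_le P i hP
  rw [Finset.card_filter] at s10
  have s11 : ∑ t ∈ wed n d ×ˢ wed n d, 1 = (n * d * (d - 1)) ^ 2 := by
    rw [Finset.sum_const, Finset.card_product, card_wed]; simp [sq]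
  rw [← Finset.card_filter, s1, s2, s6, s6, s6, s11, s3, s4, s5, s9] at h
  have t70 := s7 0
  have t71 := s7 1
  have t72 := s7 2
  have t80 := s8 0
  have t81 := s8 1
  have t82 := s8 2
  linarith

lemma double_count {ι α β γ : Type*} (S : Finset ι) (L : ι → Finset α) (X : ι → α → Finset β)
    (T : ι → Finset γ) (m : ℕ) (hX : ∀ P ∈ S, ∀ a ∈ L P, m ≤ 2 * (X P a).card)
    (φ : ι → α → β → ι × γ)
    (hmap : ∀ P ∈ S, ∀ a ∈ L P, ∀ x ∈ X P a, (φ P a x).1 ∈ S ∧ (φ P a x).2 ∈ T (φ P a x).1)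
    (hinj : ∀ P ∈ S, ∀ a ∈ L P, ∀ x ∈ X P a, ∀ P' ∈ S, ∀ a' ∈ L P', ∀ x' ∈ X P' a',
      φ P a x = φ P' a' x' → P = P' ∧ a = a' ∧ x = x') :
    m * ∑ P ∈ S, (L P).card ≤ 2 * ∑ Q ∈ S, (T Q).card := by
  have h1 : (S.sigma fun P => (L P).sigma fun a => X P a).card ≤
      (S.sigma fun Q => T Q).card := by
    refine Finset.card_le_card_of_injOn
      (fun s => ⟨(φ s.1 s.2.1 s.2.2).1, (φ s.1 s.2.1 s.2.2).2⟩) ?_ ?_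
    · rintro ⟨P, a, x⟩ h
      simp only [Finset.coe_sigma, Set.mem_sigma_iff, Finset.mem_coe] at h ⊢
      exact hmap P h.1 a h.2.1 x h.2.2
    · rintro ⟨P, a, x⟩ h ⟨P', a', x'⟩ h' hh
      simp only [Finset.coe_sigma, Set.mem_sigma_iff, Finset.mem_coe] at h h'
      simp only [Sigma.mk.injEq, heq_eq_eq] at hh
      obtain ⟨rfl, rfl, rfl⟩ := hinj P h.1 a h.2.1 x h.2.2 P' h'.1 a' h'.2.1 x' h'.2.2
        (Prod.ext hh.1 hh.2)
      rfl
  simp only [Finset.card_sigma] at h1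
  refine le_trans ?_ (Nat.mul_le_mul_left 2 h1)
  rw [Finset.mul_sum, Finset.mul_sum]
  refine Finset.sum_le_sum fun P hP => ?_
  rw [Finset.mul_sum, mul_comm, ← smul_eq_mul, ← Finset.sum_const]
  exact Finset.sum_le_sum fun a ha => hX P hP a ha

lemma reroute_f_of_ne (P : Pairing n d) (q x z : Point n d) (h1 : z ≠ q) (h2 : z ≠ P.f q)
    (h3 : z ≠ x) (h4 : P.f z ≠ x) : (conj P (Equiv.swap (P.f q) x)).f z = P.f z := by
  rw [conj_f, Equiv.symm_swap, Equiv.swap_apply_of_ne_of_ne h2 h3,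
    Equiv.swap_apply_of_ne_of_ne _ h4]
  intro h
  apply h1
  rw [← P.invol z, h, P.invol]

lemma reroute_f_self (P : Pairing n d) (q x : Point n d) (h : q ≠ x) :
    (conj P (Equiv.swap (P.f q) x)).f q = x := by
  rw [conj_f, Equiv.symm_swap, Equiv.swap_apply_of_ne_of_ne (P.nofix q).symm h,
    Equiv.swap_apply_left]

lemma bn_ne (P : Pairing n d) (hl : NoLoop P)
    (t : (Point n d × Point n d) × (Point n d × Point n d)) (h1 : t.1 ∈ wed n d)
    (hs : Sep P t) (j k : Fin 3) (hjk : j ≠ k) : bn P j t.1 ≠ bn P k t.1 := by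
  have a := hl t.1.1
  have b := hl t.1.2
  have c := hs.2
  rw [mem_wed] at h1
  fin_cases j <;> fin_cases k <;> simp_all [bn] <;> grind

/-- The points that must be left alone when rerouting. -/
def keepS (P : Pairing n d) (t : (Point n d × Point n d) × (Point n d × Point n d))
    (r : Point n d) : Finset (Point n d) :=
  {t.1.1, t.1.2, t.2.1, t.2.2, r} ∪ ({t.1.1, t.1.2, t.2.1, t.2.2, r} : Finset _).image P.f

lemma card_keepS_le (P : Pairing n d) (t : (Point n d × Point n d) × (Point n d × Point n d))
    (r : Point n d) : (keepS P t r).card ≤ 10 := by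
  have h : ({t.1.1, t.1.2, t.2.1, t.2.2, r} : Finset (Point n d)).card ≤ 5 := Finset.card_le_five
  exact (Finset.card_union_le _ _).trans (Nat.add_le_add h (Finset.card_image_le.trans h))

lemma reroute_keep (P : Pairing n d) (hl : NoLoop P)
    (t : (Point n d × Point n d) × (Point n d × Point n d)) (h1 : t.1 ∈ wed n d)
    (h2 : t.2 ∈ wed n d) (hs : Sep P t) (j k : Fin 3) (hjk : j ≠ k) (q r x : Point n d)
    (hq : q ∈ crossS P (sgl P) (bn P j t.1) (bn P j t.2))
    (hr : r ∈ crossS P (sgl P) (bn P k t.1) (bn P k t.2)) (hx : x ∉ keepS P t r) :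
    (∀ l, bn (conj P (Equiv.swap (P.f q) x)) l t.1 = bn P l t.1) ∧
    (∀ l, bn (conj P (Equiv.swap (P.f q) x)) l t.2 = bn P l t.2) ∧
    (conj P (Equiv.swap (P.f q) x)).f r = P.f r := by
  have hbn := bn_ne P hl t h1 hs j k hjk
  have hs' := hs.1
  rw [mem_wed] at h1 h2
  simp only [crossS, Finset.mem_filter] at hq hr
  simp only [keepS, Finset.mem_union, Finset.mem_image, Finset.mem_insert,
    Finset.mem_singleton, not_or, not_exists, not_and] at hx
  obtain ⟨⟨x1, x2, x3, x4, x5⟩, hx'⟩ := hx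
  have g1 := hs' 0 j
  have g2 := hs' 1 j
  have g3 := hs' 2 j
  have g4 := hs' j 0
  have g5 := hs' j 1
  have g6 := hs' j 2
  have g7 := hs' k j
  simp only [bn] at g1 g2 g3 g4 g5 g6
  have e1 : (conj P (Equiv.swap (P.f q) x)).f t.1.1 = P.f t.1.1 := by
    refine reroute_f_of_ne P q x _ ?_ ?_ (Ne.symm x1) (hx' _ (by simp))
    · rintro h; apply g2; rw [h]; exact hq.2.2
    · rintro h; apply g1; rw [h]; exact hq.2.2
  have e2 : (conj P (Equiv.swap (P.f q) x)).f t.1.2 = P.f t.1.2 := by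
    refine reroute_f_of_ne P q x _ ?_ ?_ (Ne.symm x2) (hx' _ (by simp))
    · rintro h; apply g3; rw [h]; exact hq.2.2
    · rintro h; apply g1; rw [h1.1, h]; exact hq.2.2
  have e3 : (conj P (Equiv.swap (P.f q) x)).f t.2.1 = P.f t.2.1 := by
    refine reroute_f_of_ne P q x _ ?_ ?_ (Ne.symm x3) (hx' _ (by simp))
    · rintro h; apply g4; rw [h]; exact hq.2.1.symm
    · rintro h; apply g5; rw [h, P.invol]; exact hq.2.1.symm
  have e4 : (conj P (Equiv.swap (P.f q) x)).f t.2.2 = P.f t.2.2 := by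
    refine reroute_f_of_ne P q x _ ?_ ?_ (Ne.symm x4) (hx' _ (by simp))
    · rintro h; apply g4; rw [h2.1, h]; exact hq.2.1.symm
    · rintro h; apply g6; rw [h, P.invol]; exact hq.2.1.symm
  refine ⟨?_, ?_, ?_⟩
  · intro l; fin_cases l <;> simp [bn, e1, e2]
  · intro l; fin_cases l <;> simp [bn, e3, e4]
  · refine reroute_f_of_ne P q x _ ?_ ?_ (Ne.symm x5) (hx' _ (by simp))
    · rintro rfl; apply hbn; rw [← hq.2.1, hr.2.1]
    · rintro h; apply g7; rw [← hr.2.1, h]; exact hq.2.2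

/-- Rerouted configurations. -/
def rerouted (P : Pairing n d) (j k : Fin 3) :
    Finset (Σ _ : (Point n d × Point n d) × (Point n d × Point n d),
      Point n d × Point n d × Point n d) :=
  (wed n d ×ˢ wed n d).sigma fun t =>
    (Finset.univ.filter fun q => q.1 = bn P j t.1) ×ˢ
      (Finset.univ.filter fun b => b.1 = bn P j t.2) ×ˢ
        crossS P Finset.univ (bn P k t.1) (bn P k t.2)

lemma card_rerouted (P : Pairing n d) (j k : Fin 3) :
    (rerouted P j k).card = d ^ 2 * (n * d * (d * (d - 1)) ^ 2) := by
  unfold rerouted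
  rw [Finset.card_sigma]
  simp only [Finset.card_product, card_bin, ← Finset.mul_sum]
  rw [sum_crossS]
  simp
  ring

/-- The stratum as a finset. -/
noncomputable def SDF (n d i : ℕ) : Finset (Pairing n d) := (Set.toFinite (SD n d i)).toFinset

lemma mem_SDF (P : Pairing n d) (i : ℕ) : P ∈ SDF n d i ↔ P ∈ SD n d i := by
  simp [SDF]

lemma sum_crPairs_le (i : ℕ) (j k : Fin 3) (hjk : j ≠ k)
    (hsmall : 2 * (4 * i + 2 * d + 2 * d ^ 2 + 10) ≤ n * d) :
    n * d * ∑ P ∈ SDF n d i, crPairs P j k ≤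
      2 * ((SDF n d i).card * (d ^ 2 * (n * d * (d * (d - 1)) ^ 2))) := by
  have key := double_count (SDF n d i)
    (fun P => ((wed n d ×ˢ wed n d).filter fun t => Sep P t).sigma fun t =>
      crossS P (sgl P) (bn P j t.1) (bn P j t.2) ×ˢ crossS P (sgl P) (bn P k t.1) (bn P k t.2))
    (fun P a => Finset.univ.filter fun x => Reroute P a.2.1 x ∧ x ∉ keepS P a.1 a.2.2)
    (fun Q => rerouted Q j k) (n * d) ?_
    (fun P a x => (conj P (Equiv.swap (P.f a.2.1) x), ⟨a.1, a.2.1, P.f a.2.1, a.2.2⟩)) ?_ ?_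
  · simp only [card_rerouted, Finset.card_sigma, Finset.card_product, Finset.sum_const,
      smul_eq_mul] at key
    exact key
  · intro P hP a _
    have h1 := card_reroute P i ((mem_SDF P i).1 hP) a.2.1 (keepS P a.1 a.2.2)
    have h2 := card_keepS_le P a.1 a.2.2
    omega
  · rintro P hP ⟨t, q, r⟩ ha x hx
    rw [mem_SDF] at hP
    obtain ⟨hl, -, -⟩ := (mem_SD_iff P i).1 hP
    simp only [Finset.mem_sigma, Finset.mem_filter, Finset.mem_product, Finset.mem_univ,
      true_and] at ha hx
    obtain ⟨⟨⟨w1, w2⟩, hs⟩, hq, hr⟩ := ha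
    have hkeep := reroute_keep P hl t w1 w2 hs j k hjk q r x hq hr hx.2
    have hq' := hq
    have hr' := hr
    simp only [crossS, sgl, Finset.mem_filter, Finset.mem_univ, true_and] at hq' hr'
    refine ⟨(mem_SDF _ _).2 (reroute_mem P i hP q x hq'.1 hx.1), ?_⟩
    simp only [rerouted, crossS, Finset.mem_sigma, Finset.mem_product, Finset.mem_filter,
      Finset.mem_univ, true_and]
    rw [hkeep.1, hkeep.1, hkeep.2.1, hkeep.2.1, hkeep.2.2]
    exact ⟨⟨w1, w2⟩, hq'.2.1, hq'.2.2, hr'.2.1, hr'.2.2⟩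
  · rintro P hP ⟨t, q, r⟩ ha x hx P' hP' ⟨t', q', r'⟩ ha' x' hx' h
    simp only [Prod.mk.injEq, Sigma.mk.injEq, heq_eq_eq] at h
    obtain ⟨hQ, rfl, rfl, hb, rfl⟩ := h
    simp only [Finset.mem_filter, Finset.mem_univ, true_and] at hx hx'
    have e1 := reroute_f_self P q x (by rintro rfl; exact hx.1.2.1 rfl)
    have e2 := reroute_f_self P' q x' (by rintro rfl; exact hx'.1.2.1 rfl)
    have hxx : x = x' := by rw [← e1, ← e2, hQ]
    subst hxx
    refine ⟨?_, rfl, rfl⟩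
    rw [← conj_symm_conj P (Equiv.swap (P.f q) x), hQ, hb, conj_symm_conj]

/-- The other point parallel to `p`, if `p` is on a double edge. -/
noncomputable def partner (P : Pairing n d) (p : Point n d) : Point n d :=
  if h : Dbl P p then h.choose else p

lemma partner_spec {P : Pairing n d} {p : Point n d} (h : Dbl P p) :
    partner P p ≠ p ∧ Par P p (partner P p) := by
  unfold partner
  rw [dif_pos h]
  exact h.choose_spec

/-- Relocated configurations. -/
noncomputable def relocated (P : Pairing n d) :
    Finset (Σ _ : Point n d, Point n d × Point n d × (Point n d × Point n d)) :=
  (Finset.univ.filter fun p => Dbl P p).sigma fun p' =>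
    (Finset.univ.filter fun p => p.1 = p'.1) ×ˢ (Finset.univ.filter fun a => a.1 = p'.1) ×ˢ
      (wed n d).filter fun w => Par P w.1 w.2

lemma card_relocated_le (P : Pairing n d) (i : ℕ) (hP : P ∈ SD n d i) :
    (relocated P).card ≤ 4 * i * (d * (d * (4 * i))) := by
  unfold relocated
  rw [Finset.card_sigma]
  simp only [Finset.card_product, card_bin, Finset.sum_const, smul_eq_mul]
  rw [((mem_SD_iff P i).1 hP).2.2]
  have := card_par_wed_le P i hP
  gcongr

lemma sum_dblWed_le (i : ℕ)
    (hsmall : 2 * (8 * i * (d - 1) + 4 * (d * (d - 1)) + 3 * (d * (d * (d - 1)))) ≤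
      n * d * (d - 1)) :
    n * d * (d - 1) * ∑ P ∈ SDF n d i, (dblWed P).card ≤
      2 * ((SDF n d i).card * (4 * i * (d * (d * (4 * i))))) := by
  have key := double_count (SDF n d i) (fun P => dblWed P)
    (fun P a => (wed n d).filter fun w => Relocate P a.1 w)
    (fun Q => relocated Q) (n * d * (d - 1)) ?_
    (fun P a w => (conj P ((Equiv.swap a.1 w.1).trans (Equiv.swap (partner P a.1) w.2)),
      ⟨a.2, a.1, partner P a.1, w⟩)) ?_ ?_
  · refine key.trans (Nat.mul_le_mul_left 2 ?_)
    rw [← smul_eq_mul]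
    refine Finset.sum_le_card_nsmul _ _ _ fun P hP => ?_
    exact card_relocated_le P i ((mem_SDF P i).1 hP)
  · intro P hP a _
    have h1 := card_relocate P i ((mem_SDF P i).1 hP) a.1
    omega
  · rintro P hP ⟨p, p'⟩ ha ⟨x, y⟩ hx
    rw [mem_SDF] at hP
    simp only [dblWed, Finset.mem_filter, mem_wed] at ha hx
    obtain ⟨⟨w1, w2⟩, h1, h2, h3⟩ := ha
    obtain ⟨hne, hpar⟩ := partner_spec h1
    obtain ⟨r1, r2, r3⟩ := relocate_mem P i hP p _ x y hpar hne.symm hx.1.1 hx.1.2 hx.2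
    refine ⟨(mem_SDF _ _).2 r1, ?_⟩
    simp only [relocated, Finset.mem_sigma, Finset.mem_product, Finset.mem_filter,
      Finset.mem_univ, true_and, mem_wed]
    refine ⟨r2 _ h2 w2.symm ?_, w1, ?_, hx.1, r3⟩
    · intro h; apply h3; rw [h]; exact hpar
    · rw [← hpar.1, w1]
  · rintro P hP ⟨p, p'⟩ ha ⟨x, y⟩ hx P' hP' ⟨q, q'⟩ ha' ⟨x', y'⟩ hx' h
    simp only [Prod.mk.injEq, Sigma.mk.injEq, heq_eq_eq] at h
    obtain ⟨hQ, rfl, rfl, ha, rfl, rfl⟩ := h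
    refine ⟨?_, rfl, rfl⟩
    rw [← conj_symm_conj P ((Equiv.swap p x).trans (Equiv.swap (partner P p) y)), hQ, ha,
      conj_symm_conj]

lemma sum_bA_le (m i : ℕ) (hd : 2 ≤ d) (hn : 0 < n)
    (h1 : 2 * (4 * i + 2 * d + 2 * d ^ 2 + 10) ≤ n * d)
    (h2 : 2 * (8 * i * (d - 1) + 4 * (d * (d - 1)) + 3 * (d * (d * (d - 1)))) ≤
      n * d * (d - 1)) :
    (∑ P ∈ SDF n d i, (bA m P : ℝ)) ≤ (SDF n d i).card *
      ((M2R n d ^ 2 - M2R n d * ((d : ℝ) - 1) * (16 * i + 3 * (d : ℝ) ^ 2)) +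
        (12 * i * (d * ((d : ℝ) - 1)) ^ 2 + 20 * i * M2R n d + 64 * i ^ 2 * ((d : ℝ) - 1) ^ 2 +
          48 * i * (d * ((d : ℝ) - 1)) ^ 2 + 27 * M2R n d * (d * ((d : ℝ) - 1)) +
          64 * i ^ 2 * (d : ℝ) ^ 2 + 6 * (d : ℝ) ^ 2 * (d * ((d : ℝ) - 1)) ^ 2)) := by
  have hcast : ((d - 1 : ℕ) : ℝ) = (d : ℝ) - 1 := by
    rw [Nat.cast_sub (by omega)]; simp
  have hN : (0 : ℝ) < n * d := by
    have : (0 : ℝ) < n := by exact_mod_cast hn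
    have : (0 : ℝ) < d := by exact_mod_cast (by omega : 0 < d)
    positivity
  have hpt : ∀ P ∈ SDF n d i, (bA m P : ℝ) ≤
      ((M2R n d ^ 2 - M2R n d * ((d : ℝ) - 1) * (16 * i + 3 * (d : ℝ) ^ 2)) +
        (12 * i * (d * ((d : ℝ) - 1)) ^ 2 + 20 * i * M2R n d + 64 * i ^ 2 * ((d : ℝ) - 1) ^ 2 +
          48 * i * (d * ((d : ℝ) - 1)) ^ 2 + 27 * M2R n d * (d * ((d : ℝ) - 1)))) +
      (2 * (M2R n d * (dblWed P).card) +
        ((crPairs P 0 1 : ℝ) + crPairs P 0 2 + crPairs P 1 2)) := by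
    intro P hP
    rw [mem_SDF] at hP
    have e1 := bA_le m P
    have e2 := card_good_le P i hP
    have e3 := card_sgl P i hP
    have e1' : (bA m P : ℝ) ≤ _ := Nat.cast_le.2 e1
    have e2' := (Nat.cast_le (α := ℝ)).2 e2
    have e3' := congrArg (Nat.cast (R := ℝ)) e3
    push_cast [hcast] at e2' e3'
    have e4 : ((sgl P).card : ℝ) = n * d - 4 * i := by linarith
    rw [e4] at e2'
    unfold M2R
    nlinarith
  have hsum := Finset.sum_le_sum hpt
  rw [Finset.sum_add_distrib, Finset.sum_const, nsmul_eq_mul] at hsum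
  simp only [Finset.sum_add_distrib, ← Finset.mul_sum] at hsum
  have hc : ∀ j k : Fin 3, j ≠ k → (∑ P ∈ SDF n d i, (crPairs P j k : ℝ)) ≤
      (SDF n d i).card * (2 * (d : ℝ) ^ 2 * (d * ((d : ℝ) - 1)) ^ 2) := by
    intro j k hjk
    have h := (Nat.cast_le (α := ℝ)).2 (sum_crPairs_le i j k hjk h1)
    push_cast [hcast] at h
    refine le_of_mul_le_mul_left (h.trans (le_of_eq ?_)) hN
    ring
  have hb := (Nat.cast_le (α := ℝ)).2 (sum_dblWed_le i h2)
  push_cast [hcast] at hb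
  have c1 := hc 0 1 (by decide)
  have c2 := hc 0 2 (by decide)
  have c3 := hc 1 2 (by decide)
  unfold M2R at *
  linarith

lemma main_bound (m i : ℕ) (g : ℝ) (hg : 0 ≤ g) (hi : (i : ℝ) ≤ g * (d : ℝ) ^ 2) (hd : 2 ≤ d)
    (hn : (16 * g + 11) * (d : ℝ) ^ 2 ≤ n) :
    (∑ P ∈ SDF n d i, (bA m P : ℝ)) ≤ (SDF n d i).card *
      ((M2R n d ^ 2 - M2R n d * ((d : ℝ) - 1) *
        (16 * i + 3 * (d : ℝ) ^ 2 + (d : ℝ) + 6)) +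
        (200 + 200 * g + 200 * g ^ 2) * ((d : ℝ) ^ 6 + M2R n d * (d : ℝ) ^ 2)) := by
  have hd' : (2 : ℝ) ≤ d := by exact_mod_cast hd
  have hcast : ((d - 1 : ℕ) : ℝ) = (d : ℝ) - 1 := by
    rw [Nat.cast_sub (by omega)]; simp
  have hn0 : (0 : ℝ) < n := lt_of_lt_of_le (by positivity) hn
  have hi0 : (0 : ℝ) ≤ i := Nat.cast_nonneg i
  have hnd : (16 * g + 11) * (d : ℝ) ^ 2 * 2 ≤ n * d := by
    refine (mul_le_mul_of_nonneg_right hn (by norm_num : (0 : ℝ) ≤ 2)).trans ?_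
    gcongr
  have h1 : 2 * (4 * i + 2 * d + 2 * d ^ 2 + 10) ≤ n * d := by
    rw [← Nat.cast_le (α := ℝ)]
    push_cast
    nlinarith [mul_nonneg hg (sq_nonneg (d : ℝ))]
  have h2 : 2 * (8 * i * (d - 1) + 4 * (d * (d - 1)) + 3 * (d * (d * (d - 1)))) ≤
      n * d * (d - 1) := by
    have h3 : 2 * (8 * i + 4 * d + 3 * (d * d)) ≤ n * d := by
      rw [← Nat.cast_le (α := ℝ)]
      push_cast
      nlinarith [mul_nonneg hg (sq_nonneg (d : ℝ))]
    calc _ = 2 * (8 * i + 4 * d + 3 * (d * d)) * (d - 1) := by ring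
      _ ≤ _ := Nat.mul_le_mul_right _ h3
  refine (sum_bA_le m i hd (by exact_mod_cast hn0) h1 h2).trans ?_
  refine mul_le_mul_of_nonneg_left ?_ (Nat.cast_nonneg _)
  set D := (d : ℝ)
  set M := M2R n d with hM
  have hM0 : 0 ≤ M := by
    have : 0 ≤ D - 1 := by linarith
    rw [hM, M2R]; positivity
  set I := (i : ℝ)
  have hD1 : 0 ≤ D - 1 := by linarith
  have hI2 : I ^ 2 ≤ g ^ 2 * D ^ 4 := by
    calc I ^ 2 ≤ (g * D ^ 2) ^ 2 := by gcongr
      _ = _ := by ring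
  have k1 : D * (D - 1) ≤ D ^ 2 := by nlinarith
  have k1' : 0 ≤ D * (D - 1) := by positivity
  have k2 : (D * (D - 1)) ^ 2 ≤ D ^ 4 := by
    calc _ ≤ (D ^ 2) ^ 2 := by gcongr
      _ = _ := by ring
  have k3 : (D - 1) ^ 2 ≤ D ^ 2 := by gcongr; linarith
  have t1 : I * (D * (D - 1)) ^ 2 ≤ g * D ^ 6 := by
    calc _ ≤ (g * D ^ 2) * D ^ 4 := by gcongr
      _ = _ := by ring
  have t2 : I * M ≤ g * (M * D ^ 2) := by
    calc _ ≤ (g * D ^ 2) * M := by gcongr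
      _ = _ := by ring
  have t3 : I ^ 2 * (D - 1) ^ 2 ≤ g ^ 2 * D ^ 6 := by
    calc _ ≤ (g ^ 2 * D ^ 4) * D ^ 2 := by gcongr
      _ = _ := by ring
  have t4 : I ^ 2 * D ^ 2 ≤ g ^ 2 * D ^ 6 := by
    calc _ ≤ (g ^ 2 * D ^ 4) * D ^ 2 := by gcongr
      _ = _ := by ring
  have t5 : M * (D * (D - 1)) ≤ M * D ^ 2 := by gcongr
  have t6 : D ^ 2 * (D * (D - 1)) ^ 2 ≤ D ^ 6 := by
    calc _ ≤ D ^ 2 * D ^ 4 := by gcongr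
      _ = _ := by ring
  have t7 : M * ((D - 1) * (D + 6)) ≤ M * (4 * D ^ 2) := by
    refine mul_le_mul_of_nonneg_left ?_ hM0
    nlinarith
  have p1 : 0 ≤ D ^ 6 := by positivity
  have p2 : 0 ≤ g * D ^ 6 := by positivity
  have p3 : 0 ≤ g ^ 2 * D ^ 6 := by positivity
  have p4 : 0 ≤ M * D ^ 2 := by positivity
  have p5 : 0 ≤ g * (M * D ^ 2) := by positivity
  have p6 : 0 ≤ g ^ 2 * (M * D ^ 2) := by positivity
  nlinarith

lemma eventually_sq_le (d : ℕ → ℕ) (K : ℝ) (hK : 0 < K)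
    (hdo : Filter.Tendsto (fun n : ℕ => (d n : ℝ) / Real.sqrt n) Filter.atTop (nhds 0)) :
    ∃ n0 : ℕ, ∀ n : ℕ, n0 ≤ n → K * (d n : ℝ) ^ 2 ≤ n := by
  have h := hdo.pow 2
  have h2 := h.eventually (gt_mem_nhds (show (0 : ℝ) ^ 2 < 1 / K by simpa using hK))
  obtain ⟨n0, hn0⟩ := Filter.eventually_atTop.1 (h2.and (Filter.eventually_gt_atTop 0))
  refine ⟨n0, fun n hn => ?_⟩
  obtain ⟨h3, h4⟩ := hn0 n hn
  have hn' : (0 : ℝ) < n := by exact_mod_cast h4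
  rw [div_pow, Real.sq_sqrt hn'.le, div_lt_div_iff₀ hn' hK] at h3
  linarith

end Helpers

/-- For `P` uniformly random in `S_i` (`0 ≤ i ≤ i1 - 1`), the expected number of
class A switchings producing `P` satisfies
`E[b_A(P)] ≤ (M2² - M2 (d-1) (16 i + 3 d² + d + 6)) + O(d⁶ + M2 d²)`. -/
theorem stmt_14 (γ : ℝ) (hγ : 0 < γ) (d : ℕ → ℕ) (hd : ∀ n, 2 ≤ d n)
    (hdo : Filter.Tendsto (fun n : ℕ => (d n : ℝ) / Real.sqrt n) Filter.atTop
      (nhds 0)) :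
    ∃ C : ℝ, 0 < C ∧ ∃ n0 : ℕ, ∀ n : ℕ, n0 ≤ n → Even (d n * n) →
      ∀ i : ℕ, i + 1 ≤ i1Nat (d n) γ → (SD n (d n) i).Nonempty →
      (∑ᶠ P ∈ SD n (d n) i, (bA (i1Nat (d n) γ) P : ℝ)) /
          (Nat.card {P : Pairing n (d n) // P ∈ SD n (d n) i} : ℝ)
        ≤ (M2R n (d n) ^ 2 -
              M2R n (d n) * ((d n : ℝ) - 1) *
                (16 * i + 3 * (d n : ℝ) ^ 2 + (d n : ℝ) + 6)) +
            C * ((d n : ℝ) ^ 6 + M2R n (d n) * (d n : ℝ) ^ 2) := by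
  have hg : 0 ≤ 1 + γ := by linarith
  obtain ⟨n0, hn0⟩ := eventually_sq_le d (16 * (1 + γ) + 11) (by positivity) hdo
  refine ⟨200 + 200 * (1 + γ) + 200 * (1 + γ) ^ 2, by positivity, n0, ?_⟩
  intro n hn _ i hi hne
  have hd2 : (2 : ℝ) ≤ d n := by exact_mod_cast hd n
  have hi' : (i : ℝ) ≤ (1 + γ) * (d n : ℝ) ^ 2 := by
    unfold i1Nat at hi
    have h1 : (i : ℤ) ≤ ⌊(1 + γ) * ((d n : ℝ) - 1) ^ 2 / 4⌋ := by omega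
    have h2 := Int.le_floor.1 h1
    push_cast at h2
    have h3 : ((d n : ℝ) - 1) ^ 2 ≤ (d n : ℝ) ^ 2 := by nlinarith
    have h4 := mul_le_mul_of_nonneg_left h3 hg
    have h5 : 0 ≤ (1 + γ) * ((d n : ℝ) - 1) ^ 2 := by positivity
    linarith
  have key := main_bound (i1Nat (d n) γ) i (1 + γ) hg hi' (hd n) (hn0 n hn)
  rw [finsum_mem_eq_finite_toFinset_sum _ (Set.toFinite (SD n (d n) i))]
  have hcard : Nat.card {P : Pairing n (d n) // P ∈ SD n (d n) i} = (SDF n (d n) i).card :=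
    (Nat.subtype_card _ fun P => mem_SDF P i)
  have hpos : (0 : ℝ) < (SDF n (d n) i).card := by
    obtain ⟨P, hP⟩ := hne
    exact_mod_cast Finset.card_pos.2 ⟨P, (mem_SDF P i).2 hP⟩
  rw [hcard, div_le_iff₀ hpos, mul_comm]
  exact key

end Reg
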